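/- arXiv:2405.17819 — 5 statements merged into one kernel-verified Lean document; each statement's English description precedes it below -/
import Mathlib

section
/- Let G be a (P2+P3, gem)-free graph containing an induced 5-cycle with vertex set C = {v1,…,v5} as in the setup, with the sets A_i, B_i, X_i, Y_i, Z_i, T defined accordingly. Then for each i ∈ {1,…,5} (indices mod 5): (M6) Z_i is anticomplete to (Z \ Z_i) ∪ X_{i+1} ∪ X_{i−1}; moreover, if Z_i and Z_{i+1} are both nonempty then Z_i ∪ Z_{i+1} is a stable set, and likewise if Z_i and Z_{i−1} are both nonempty then Z_i ∪ Z_{i−1} is a stable set; (M7) the vertex set of any big component of G[Z_i] is complete to Y_i, the vertex set of any big component of G[X_{i+1}] is complete to Y_i, and the vertex set of any big component of G[X_{i−1}] is complete to Y_i; (M8) the vertex set of any big component of G[X_i] is complete to Z_{i+2} ∪ Z_{i−2}. -/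
open SimpleGraph

/-- The graph `P2 + P3` (disjoint union of a path on 2 and a path on 3 vertices). -/
def graphP2P3 : SimpleGraph (Fin 5) :=
  SimpleGraph.fromRel (fun x y => (x, y) ∈ ([(0,1),(2,3),(3,4)] : List (Fin 5 × Fin 5)))

/-- The gem: a path `P4` (0-1-2-3) plus a vertex 4 adjacent to all of it. -/
def graphGem : SimpleGraph (Fin 5) :=
  SimpleGraph.fromRel (fun x y =>
    (x, y) ∈ ([(0,1),(1,2),(2,3),(4,0),(4,1),(4,2),(4,3)] : List (Fin 5 × Fin 5)))

/-- The path on three vertices. -/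
def graphP3 : SimpleGraph (Fin 3) :=
  SimpleGraph.fromRel (fun x y => (x, y) ∈ ([(0,1),(1,2)] : List (Fin 3 × Fin 3)))

/-- The cycle on five vertices. -/
def graphC5 : SimpleGraph (Fin 5) :=
  SimpleGraph.fromRel (fun x y => y = x + 1)

/-- `F1`: a 5-cycle `v1 v2 v3 v4 v5` (vertices 0..4) plus a vertex 5 adjacent
exactly to `v5, v1, v2` (i.e. 4, 0, 1). -/
def graphF1 : SimpleGraph (Fin 6) :=
  SimpleGraph.fromRel (fun x y =>
    (x, y) ∈ ([(0,1),(1,2),(2,3),(3,4),(4,0),(5,4),(5,0),(5,1)] : List (Fin 6 × Fin 6)))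

/-- `F1'`: a 5-cycle (0..4) plus adjacent vertices 5, 6, where 5 is adjacent to 4,0,1
and 6 is adjacent to 0,1,2. -/
def graphF1' : SimpleGraph (Fin 7) :=
  SimpleGraph.fromRel (fun x y =>
    (x, y) ∈ ([(0,1),(1,2),(2,3),(3,4),(4,0),(5,4),(5,0),(5,1),(6,0),(6,1),(6,2),(5,6)] :
      List (Fin 7 × Fin 7)))

/-- `F1''`: a 5-cycle (0..4) plus nonadjacent vertices 5, 6, where 5 is adjacent to 4,0,1
and 6 is adjacent to 1,2,3. -/
def graphF1'' : SimpleGraph (Fin 7) :=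
  SimpleGraph.fromRel (fun x y =>
    (x, y) ∈ ([(0,1),(1,2),(2,3),(3,4),(4,0),(5,4),(5,0),(5,1),(6,1),(6,2),(6,3)] :
      List (Fin 7 × Fin 7)))

/-- `F2`: a 5-cycle (0..4) plus adjacent vertices 5, 6, each adjacent to `v1,v3,v4`
(i.e. 0, 2, 3). -/
def graphF2 : SimpleGraph (Fin 7) :=
  SimpleGraph.fromRel (fun x y =>
    (x, y) ∈ ([(0,1),(1,2),(2,3),(3,4),(4,0),(5,6),(5,0),(5,2),(5,3),(6,0),(6,2),(6,3)] :
      List (Fin 7 × Fin 7)))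

/-- `F3`: a 5-cycle (0..4) plus adjacent vertices 5 (adjacent to 0,2,3) and
6 (adjacent to 2,3). -/
def graphF3 : SimpleGraph (Fin 7) :=
  SimpleGraph.fromRel (fun x y =>
    (x, y) ∈ ([(0,1),(1,2),(2,3),(3,4),(4,0),(5,6),(5,0),(5,2),(5,3),(6,2),(6,3)] :
      List (Fin 7 × Fin 7)))

/-- `G` contains no induced copy of `H`. -/
def IsFreeOf {W V : Type*} (G : SimpleGraph V) (H : SimpleGraph W) : Prop :=
  IsEmpty (H ↪g G)

/-- The disjoint union of a clique blowup `C5⟨K_{t 0},…,K_{t 4}⟩` of the 5-cycle and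
`ℓ` isolated vertices. -/
def blowupC5 (t : Fin 5 → ℕ) (ℓ : ℕ) :
    SimpleGraph ((Σ i : Fin 5, Fin (t i)) ⊕ Fin ℓ) :=
  SimpleGraph.fromRel (fun x y => ∃ a b, x = Sum.inl a ∧ y = Sum.inl b ∧
    (a.1 = b.1 ∨ b.1 = a.1 + 1))

/-- Membership in the class `𝒞`: `G` is isomorphic to the disjoint union of a clique
blowup of `C5` and some number of isolated vertices. -/
def InClassC {V : Type*} (G : SimpleGraph V) : Prop :=
  ∃ (t : Fin 5 → ℕ) (ℓ : ℕ), (∀ i, 0 < t i) ∧ Nonempty (G ≃g blowupC5 t ℓ)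

/-- The function φ from the paper. -/
noncomputable def phi (x : ℕ) : ℕ :=
  if x = 1 then 1 else if x = 2 then 4 else if x = 3 then 6
  else ⌈(5 * (x : ℚ) - 1) / 4⌉₊

section Stmt
variable {V : Type*} (G : SimpleGraph V)

/-- `S` is complete to `S'`. -/
def CompleteTo (S S' : Set V) : Prop := ∀ x ∈ S, ∀ y ∈ S', G.Adj x y

/-- `S` is anticomplete to `S'`. -/
def AnticompleteTo (S S' : Set V) : Prop := ∀ x ∈ S, ∀ y ∈ S', ¬ G.Adj x y

/-- `S` is a stable (independent) set. -/
def IsStableSet (S : Set V) : Prop := S.Pairwise (fun x y => ¬ G.Adj x y)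

/-- A graph is perfect if every induced subgraph has chromatic number equal to
its clique number. -/
def IsPerfect : Prop :=
  ∀ S : Set V, (G.induce S).chromaticNumber = ((G.induce S).cliqueNum : ℕ∞)

variable (v : Fin 5 → V)

/-- `v` induces a `C5` in `G`: two cycle vertices are adjacent iff consecutive. -/
def IsInducedC5 : Prop :=
  Function.Injective v ∧ ∀ i j : Fin 5, G.Adj (v i) (v j) ↔ (j = i + 1 ∨ i = j + 1)

def setA (i : Fin 5) : Set V :=
  {u | u ∉ Set.range v ∧ ∀ j, G.Adj u (v j) ↔ j = i}

def setB (i : Fin 5) : Set V :=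
  {u | u ∉ Set.range v ∧ ∀ j, G.Adj u (v j) ↔ (j = i ∨ j = i + 1)}

def setX (i : Fin 5) : Set V :=
  {u | u ∉ Set.range v ∧ ∀ j, G.Adj u (v j) ↔ (j = i - 1 ∨ j = i + 1)}

def setY (i : Fin 5) : Set V :=
  {u | u ∉ Set.range v ∧ ∀ j, G.Adj u (v j) ↔ (j = i - 1 ∨ j = i ∨ j = i + 1)}

def setZ (i : Fin 5) : Set V :=
  {u | u ∉ Set.range v ∧ ∀ j, G.Adj u (v j) ↔ (j = i - 2 ∨ j = i ∨ j = i + 2)}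

def setT : Set V :=
  {u | u ∉ Set.range v ∧ ∀ j, ¬ G.Adj u (v j)}

end Stmt

/-- `u` lies in a big component (a connected component with at least two vertices)
of the subgraph of `G` induced by `S`. -/
def InBigComponent {V : Type*} (G : SimpleGraph V) (S : Set V) (u : S) : Prop :=
  ∃ w : S, w ≠ u ∧ (G.induce S).Reachable u w

/-- A gem-free graph has no induced path `a b c d` together with a vertex `e` adjacent to
all of it. -/
theorem IsFreeOf.not_gem {V : Type*} {G : SimpleGraph V} (h : IsFreeOf G graphGem)
    {a b c d : V} (e : V) (hab : G.Adj a b) (hbc : G.Adj b c) (hcd : G.Adj c d)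
    (hac : ¬ G.Adj a c) (hbd : ¬ G.Adj b d) (had : ¬ G.Adj a d)
    (hea : G.Adj e a) (heb : G.Adj e b) (hec : G.Adj e c) (hed : G.Adj e d) : False := by
  have nac : a ≠ c := by rintro rfl; exact had hcd
  have nbd : b ≠ d := by rintro rfl; exact had hab
  have nad : a ≠ d := by rintro rfl; exact hbd hab.symm
  refine h.elim ⟨⟨![a, b, c, d, e], ?_⟩, ?_⟩
  · intro x y
    fin_cases x <;> fin_cases y <;>
      simp [nac, nbd, nad, nac.symm, nbd.symm, nad.symm, hab.ne, hbc.ne, hcd.ne, hea.ne, heb.ne,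
        hec.ne, hed.ne, hab.ne', hbc.ne', hcd.ne', hea.ne', heb.ne', hec.ne', hed.ne']
  · intro x y
    change G.Adj (![a, b, c, d, e] x) (![a, b, c, d, e] y) ↔ _
    fin_cases x <;> fin_cases y <;>
      simp [graphGem, hab, hbc, hcd, hac, hbd, had, hea, heb, hec, hed, hab.symm, hbc.symm,
        hcd.symm, mt Adj.symm hac, mt Adj.symm hbd, mt Adj.symm had, hea.symm, heb.symm, hec.symm,
        hed.symm]

/-- A `P2 + P3`-free graph has no edge `a b` anticomplete to an induced path `c d e`. -/
theorem IsFreeOf.not_P2P3 {V : Type*} {G : SimpleGraph V} (h : IsFreeOf G graphP2P3)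
    {a b c d e : V} (hab : G.Adj a b) (hcd : G.Adj c d) (hde : G.Adj d e)
    (hce : ¬ G.Adj c e) (nce : c ≠ e)
    (hac : ¬ G.Adj a c) (had : ¬ G.Adj a d) (hae : ¬ G.Adj a e)
    (hbc : ¬ G.Adj b c) (hbd : ¬ G.Adj b d) (hbe : ¬ G.Adj b e) : False := by
  have nac : a ≠ c := by rintro rfl; exact had hcd
  have nad : a ≠ d := by rintro rfl; exact hae hde
  have nae : a ≠ e := by rintro rfl; exact had hde.symm
  have nbc : b ≠ c := by rintro rfl; exact hbd hcd
  have nbd : b ≠ d := by rintro rfl; exact hbe hde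
  have nbe : b ≠ e := by rintro rfl; exact hbd hde.symm
  refine h.elim ⟨⟨![a, b, c, d, e], ?_⟩, ?_⟩
  · intro x y
    fin_cases x <;> fin_cases y <;>
      simp [nac, nad, nae, nbc, nbd, nbe, nce, nac.symm, nad.symm, nae.symm, nbc.symm, nbd.symm,
        nbe.symm, nce.symm, hab.ne, hcd.ne, hde.ne, hab.ne', hcd.ne', hde.ne']
  · intro x y
    change G.Adj (![a, b, c, d, e] x) (![a, b, c, d, e] y) ↔ _
    fin_cases x <;> fin_cases y <;>
      simp [graphP2P3, hab, hcd, hde, hce, hac, had, hae, hbc, hbd, hbe, hab.symm, hcd.symm,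
        hde.symm, mt Adj.symm hce, mt Adj.symm hac, mt Adj.symm had, mt Adj.symm hae, mt Adj.symm hbc,
        mt Adj.symm hbd, mt Adj.symm hbe]

section Dihedral
variable {V : Type*} {G : SimpleGraph V} {v : Fin 5 → V} {u : V} {i d k : Fin 5}

theorem IsInducedC5.dihedral (hC : IsInducedC5 G v) (hd : d = 1 ∨ d = -1) :
    IsInducedC5 G (fun j => v (i + d * j)) := by
  refine ⟨fun x y hxy => ?_, fun x y => (hC.2 _ _).trans ?_⟩
  · have := hC.1 hxy
    clear hxy hC
    revert i d x y
    decide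
  · clear hC
    revert i d x y
    decide

theorem mem_setX_dihedral (hd : d = 1 ∨ d = -1) (hu : u ∈ setX G v (i + d * k)) :
    u ∈ setX G (fun j => v (i + d * j)) k := by
  refine ⟨fun ⟨j, hj⟩ => hu.1 ⟨_, hj⟩, fun j => (hu.2 _).trans ?_⟩
  clear hu
  revert i d k j
  decide

theorem mem_setY_dihedral (hd : d = 1 ∨ d = -1) (hu : u ∈ setY G v (i + d * k)) :
    u ∈ setY G (fun j => v (i + d * j)) k := by
  refine ⟨fun ⟨j, hj⟩ => hu.1 ⟨_, hj⟩, fun j => (hu.2 _).trans ?_⟩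
  clear hu
  revert i d k j
  decide

theorem mem_setZ_dihedral (hd : d = 1 ∨ d = -1) (hu : u ∈ setZ G v (i + d * k)) :
    u ∈ setZ G (fun j => v (i + d * j)) k := by
  refine ⟨fun ⟨j, hj⟩ => hu.1 ⟨_, hj⟩, fun j => (hu.2 _).trans ?_⟩
  clear hu
  revert i d k j
  decide

end Dihedral

section Base
variable {V : Type*} {G : SimpleGraph V} {v : Fin 5 → V} {x x' y z z' w : V}

theorem not_adj_setZ_zero_setZ_one (h2 : IsFreeOf G graphGem) (hC : IsInducedC5 G v)
    (hz : z ∈ setZ G v 0) (hw : w ∈ setZ G v 1) : ¬ G.Adj z w := by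
  intro h
  refine h2.not_gem (a := v 2) (b := z) (c := w) (d := v 4) (v 3) ?_ h ?_ ?_ ?_ ?_ ?_ ?_ ?_ ?_ <;>
    simp only [G.adj_comm (v _) z, G.adj_comm (v _) w, hz.2, hw.2, hC.2] <;> decide

theorem not_adj_setZ_zero_setZ_two (h2 : IsFreeOf G graphGem) (hC : IsInducedC5 G v)
    (hz : z ∈ setZ G v 0) (hw : w ∈ setZ G v 2) : ¬ G.Adj z w := by
  intro h
  refine h2.not_gem (a := v 3) (b := v 2) (c := w) (d := v 0) z ?_ ?_ ?_ ?_ ?_ ?_ ?_ ?_ h ?_ <;>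
    simp only [G.adj_comm (v _) w, hz.2, hw.2, hC.2] <;> decide

theorem not_adj_setZ_zero_setX_one (h2 : IsFreeOf G graphGem) (hC : IsInducedC5 G v)
    (hz : z ∈ setZ G v 0) (hx : x ∈ setX G v 1) : ¬ G.Adj z x := by
  intro h
  refine h2.not_gem (a := v 0) (b := x) (c := v 2) (d := v 3) z ?_ ?_ ?_ ?_ ?_ ?_ ?_ h ?_ ?_ <;>
    simp only [G.adj_comm (v _) x, hz.2, hx.2, hC.2] <;> decide

theorem not_adj_setZ_zero_of_mem_setZ_one (h1 : IsFreeOf G graphP2P3) (h2 : IsFreeOf G graphGem)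
    (hC : IsInducedC5 G v) (hz : z ∈ setZ G v 0) (hz' : z' ∈ setZ G v 0) (hw : w ∈ setZ G v 1) :
    ¬ G.Adj z z' := by
  intro h
  refine h1.not_P2P3 (c := v 1) (d := w) (e := v 4) h ?_ ?_ ?_ (hC.1.ne (by decide)) ?_
    (not_adj_setZ_zero_setZ_one h2 hC hz hw) ?_ ?_ (not_adj_setZ_zero_setZ_one h2 hC hz' hw) ?_ <;>
    simp only [G.adj_comm (v _) w, hz.2, hz'.2, hw.2, hC.2] <;> decide

theorem not_adj_setZ_one_of_mem_setZ_zero (h1 : IsFreeOf G graphP2P3) (h2 : IsFreeOf G graphGem)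
    (hC : IsInducedC5 G v) (hz : z ∈ setZ G v 1) (hz' : z' ∈ setZ G v 1) (hw : w ∈ setZ G v 0) :
    ¬ G.Adj z z' := by
  intro h
  refine h1.not_P2P3 (c := v 0) (d := w) (e := v 2) h ?_ ?_ ?_ (hC.1.ne (by decide)) ?_
    (fun h => not_adj_setZ_zero_setZ_one h2 hC hw hz h.symm) ?_ ?_
    (fun h => not_adj_setZ_zero_setZ_one h2 hC hw hz' h.symm) ?_ <;>
    simp only [G.adj_comm (v _) w, hz.2, hz'.2, hw.2, hC.2] <;> decide

theorem adj_setZ_zero_setY_zero (h1 : IsFreeOf G graphP2P3) (h2 : IsFreeOf G graphGem)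
    (hC : IsInducedC5 G v) (hz : z ∈ setZ G v 0) (hz' : z' ∈ setZ G v 0) (hzz : G.Adj z z')
    (hy : y ∈ setY G v 0) : G.Adj z y := by
  by_contra hn
  by_cases hn' : G.Adj z' y
  · refine h2.not_gem (a := z) (b := z') (c := y) (d := v 1) (v 0) hzz hn' ?_ hn
      ?_ ?_ ?_ ?_ ?_ ?_ <;>
      simp only [G.adj_comm (v _) z, G.adj_comm (v _) z', G.adj_comm (v _) y,
        hz.2, hz'.2, hy.2, hC.2] <;> decide
  · refine h1.not_P2P3 (c := v 1) (d := y) (e := v 4) hzz ?_ ?_ ?_ (hC.1.ne (by decide)) ?_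
      hn ?_ ?_ hn' ?_ <;>
      simp only [G.adj_comm (v _) y, hz.2, hz'.2, hy.2, hC.2] <;> decide

theorem adj_setX_one_setY_zero (h1 : IsFreeOf G graphP2P3) (h2 : IsFreeOf G graphGem)
    (hC : IsInducedC5 G v) (hx : x ∈ setX G v 1) (hx' : x' ∈ setX G v 1) (hxx : G.Adj x x')
    (hy : y ∈ setY G v 0) : G.Adj x y := by
  by_contra hn
  by_cases hn' : G.Adj x' y
  · refine h2.not_gem (a := x) (b := x') (c := y) (d := v 4) (v 0) hxx hn' ?_ hn
      ?_ ?_ ?_ ?_ ?_ ?_ <;>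
      simp only [G.adj_comm (v _) x, G.adj_comm (v _) x', G.adj_comm (v _) y,
        hx.2, hx'.2, hy.2, hC.2] <;> decide
  · refine h1.not_P2P3 (c := v 1) (d := y) (e := v 4) hxx ?_ ?_ ?_ (hC.1.ne (by decide)) ?_
      hn ?_ ?_ hn' ?_ <;>
      simp only [G.adj_comm (v _) y, hx.2, hx'.2, hy.2, hC.2] <;> decide

theorem adj_setX_zero_setZ_two (h1 : IsFreeOf G graphP2P3) (h2 : IsFreeOf G graphGem)
    (hC : IsInducedC5 G v) (hx : x ∈ setX G v 0) (hx' : x' ∈ setX G v 0) (hxx : G.Adj x x')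
    (hz : z ∈ setZ G v 2) : G.Adj x z := by
  by_contra hn
  by_cases hn' : G.Adj x' z
  · refine h2.not_gem (a := x) (b := x') (c := z) (d := v 0) (v 4) hxx hn' ?_ hn
      ?_ ?_ ?_ ?_ ?_ ?_ <;>
      simp only [G.adj_comm (v _) x, G.adj_comm (v _) x', G.adj_comm (v _) z,
        hx.2, hx'.2, hz.2, hC.2] <;> decide
  · refine h1.not_P2P3 (c := v 0) (d := z) (e := v 2) hxx ?_ ?_ ?_ (hC.1.ne (by decide)) ?_
      hn ?_ ?_ hn' ?_ <;>
      simp only [G.adj_comm (v _) z, hx.2, hx'.2, hz.2, hC.2] <;> decide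

end Base

/-- A vertex of a big component has a neighbor in that component. -/
theorem InBigComponent.exists_adj {V : Type*} {G : SimpleGraph V} {S : Set V} {u : S}
    (h : InBigComponent G S u) : ∃ w ∈ S, G.Adj u w := by
  obtain ⟨w, hne, ⟨p⟩⟩ := h
  cases p with
  | nil => exact absurd rfl hne
  | cons hadj _ => exact ⟨_, Subtype.property _, hadj⟩

/-- The interaction of `Z_i`, `X_i` and `Y_i` with the sets on either side, where `d = 1` and
`d = -1` are the two directions around the cycle. -/
theorem setXYZ_adj_of_direction {V : Type*} {G : SimpleGraph V} (h1 : IsFreeOf G graphP2P3)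
    (h2 : IsFreeOf G graphGem) {v : Fin 5 → V} (hC : IsInducedC5 G v) (i d : Fin 5)
    (hd : d = 1 ∨ d = -1) :
    AnticompleteTo G (setZ G v i) (setZ G v (i + d)) ∧
    AnticompleteTo G (setZ G v i) (setZ G v (i + d * 2)) ∧
    AnticompleteTo G (setZ G v i) (setX G v (i + d)) ∧
    ((setZ G v i).Nonempty → (setZ G v (i + d)).Nonempty →
      IsStableSet G (setZ G v i ∪ setZ G v (i + d))) ∧
    (∀ u : setX G v (i + d), InBigComponent G (setX G v (i + d)) u →
      ∀ y ∈ setY G v i, G.Adj u.1 y) ∧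
    (∀ u : setX G v i, InBigComponent G (setX G v i) u →
      ∀ z ∈ setZ G v (i + d * 2), G.Adj u.1 z) := by
  have hC' := hC.dihedral (i := i) hd
  have e0 : i + d * 0 = i := by simp
  have e1 : i + d * 1 = i + d := by simp
  have X0 {u} (hu : u ∈ setX G v i) := mem_setX_dihedral (k := 0) hd (e0.symm ▸ hu)
  have X1 {u} (hu : u ∈ setX G v (i + d)) := mem_setX_dihedral (k := 1) hd (e1.symm ▸ hu)
  have Y0 {u} (hu : u ∈ setY G v i) := mem_setY_dihedral (k := 0) hd (e0.symm ▸ hu)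
  have Z0 {u} (hu : u ∈ setZ G v i) := mem_setZ_dihedral (k := 0) hd (e0.symm ▸ hu)
  have Z1 {u} (hu : u ∈ setZ G v (i + d)) := mem_setZ_dihedral (k := 1) hd (e1.symm ▸ hu)
  have Z2 {u} (hu : u ∈ setZ G v (i + d * 2)) := mem_setZ_dihedral (k := 2) hd hu
  refine ⟨fun z hz w hw => not_adj_setZ_zero_setZ_one h2 hC' (Z0 hz) (Z1 hw),
    fun z hz w hw => not_adj_setZ_zero_setZ_two h2 hC' (Z0 hz) (Z2 hw),
    fun z hz x hx => not_adj_setZ_zero_setX_one h2 hC' (Z0 hz) (X1 hx), ?_, ?_, ?_⟩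
  · rintro ⟨a, ha⟩ ⟨b, hb⟩ p (hp | hp) q (hq | hq) -
    · exact not_adj_setZ_zero_of_mem_setZ_one h1 h2 hC' (Z0 hp) (Z0 hq) (Z1 hb)
    · exact not_adj_setZ_zero_setZ_one h2 hC' (Z0 hp) (Z1 hq)
    · exact fun h => not_adj_setZ_zero_setZ_one h2 hC' (Z0 hq) (Z1 hp) h.symm
    · exact not_adj_setZ_one_of_mem_setZ_zero h1 h2 hC' (Z1 hp) (Z1 hq) (Z0 ha)
  · intro u hu y hy
    obtain ⟨w, hw, huw⟩ := hu.exists_adj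
    exact adj_setX_one_setY_zero h1 h2 hC' (X1 u.2) (X1 hw) huw (Y0 hy)
  · intro u hu z hz
    obtain ⟨w, hw, huw⟩ := hu.exists_adj
    exact adj_setX_zero_setZ_two h1 h2 hC' (X0 u.2) (X0 hw) huw (Z2 hz)

/-- Properties (M6)–(M8) of the partition of a (P2+P3, gem)-free graph with
respect to an induced 5-cycle. -/
theorem properties_M6_M8 {V : Type*} [Fintype V] (G : SimpleGraph V)
    (h1 : IsFreeOf G graphP2P3) (h2 : IsFreeOf G graphGem)
    (v : Fin 5 → V) (hC : IsInducedC5 G v) :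
    ∀ i : Fin 5,
      (AnticompleteTo G (setZ G v i)
          (((⋃ j, setZ G v j) \ setZ G v i) ∪ setX G v (i+1) ∪ setX G v (i-1)) ∧
        ((setZ G v i).Nonempty → (setZ G v (i+1)).Nonempty →
          IsStableSet G (setZ G v i ∪ setZ G v (i+1))) ∧
        ((setZ G v i).Nonempty → (setZ G v (i-1)).Nonempty →
          IsStableSet G (setZ G v i ∪ setZ G v (i-1)))) ∧
      ((∀ u : setZ G v i, InBigComponent G (setZ G v i) u →
          ∀ y ∈ setY G v i, G.Adj u.1 y) ∧
        (∀ u : setX G v (i+1), InBigComponent G (setX G v (i+1)) u →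
          ∀ y ∈ setY G v i, G.Adj u.1 y) ∧
        (∀ u : setX G v (i-1), InBigComponent G (setX G v (i-1)) u →
          ∀ y ∈ setY G v i, G.Adj u.1 y)) ∧
      (∀ u : setX G v i, InBigComponent G (setX G v i) u →
        ∀ z ∈ setZ G v (i+2) ∪ setZ G v (i-2), G.Adj u.1 z) := by
  intro i
  obtain ⟨zz, zz2, zx, zs, xy, xz⟩ := setXYZ_adj_of_direction h1 h2 hC i 1 (Or.inl rfl)
  obtain ⟨zz', zz2', zx', zs', xy', xz'⟩ := setXYZ_adj_of_direction h1 h2 hC i (-1) (Or.inr rfl)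
  rw [← sub_eq_add_neg] at zz' zx' zs' xy'
  rw [one_mul] at zz2 xz
  rw [neg_one_mul, ← sub_eq_add_neg] at zz2' xz'
  refine ⟨⟨?_, zs, zs'⟩, ⟨?_, xy, xy'⟩, ?_⟩
  · rintro z hz w ((⟨hw, hwi⟩ | hw) | hw)
    · obtain ⟨j, hj⟩ := Set.mem_iUnion.1 hw
      have hcases : ∀ i j : Fin 5, j = i ∨ j = i + 1 ∨ j = i - 1 ∨ j = i + 2 ∨ j = i - 2 := by
        decide
      obtain rfl | rfl | rfl | rfl | rfl := hcases i j
      · exact absurd hj hwi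
      · exact zz z hz w hj
      · exact zz' z hz w hj
      · exact zz2 z hz w hj
      · exact zz2' z hz w hj
    · exact zx z hz w hw
    · exact zx' z hz w hw
  · intro u hu y hy
    obtain ⟨w, hw, huw⟩ := hu.exists_adj
    have hC' := hC.dihedral (i := i) (Or.inl rfl)
    have e0 : i + 1 * 0 = i := by simp
    exact adj_setZ_zero_setY_zero h1 h2 hC'
      (mem_setZ_dihedral (Or.inl rfl) (e0.symm ▸ u.2))
      (mem_setZ_dihedral (Or.inl rfl) (e0.symm ▸ hw)) huw
      (mem_setY_dihedral (Or.inl rfl) (e0.symm ▸ hy))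
  · rintro u hu z (hz | hz)
    · exact xz u hu z hz
    · exact xz' u hu z hz
end

section
/- Let G be a (P2+P3, gem)-free graph containing an induced 5-cycle with vertex set C = {v1,…,v5} as in the setup, with the sets A_i, B_i, X_i, Z_i defined accordingly. Then for each i ∈ {1,…,5} (indices mod 5): (L1) G[X_i] is P3-free, and hence is a disjoint union of complete graphs; (L2) if X_i is a stable set, then χ(G[A_i ∪ A_{i+1} ∪ A_{i−1} ∪ B_i ∪ B_{i−1} ∪ X_i ∪ {v_i, v_{i+2}, v_{i−2}}]) ≤ 2; (L3) G[Z_i] is perfect, and hence χ(G[Z_i]) = ω(G[Z_i]) ≤ ω(G) − 2. -/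
open SimpleGraph

section P4Free

variable {V : Type*} {G : SimpleGraph V}

/-- `G` contains no induced path on four vertices. -/
def IsP4Free (G : SimpleGraph V) : Prop :=
  ∀ ⦃a b c d⦄, G.Adj a b → G.Adj b c → G.Adj c d → ¬ G.Adj a c → ¬ G.Adj b d → G.Adj a d

theorem IsP4Free.comap {W : Type*} (h : IsP4Free G) (f : W → V) : IsP4Free (G.comap f) :=
  fun _ _ _ _ hab hbc hcd hac hbd => h hab hbc hcd hac hbd

/-- In a `P4`-free graph, a stable set dominating a clique has a vertex complete to it. -/
theorem IsP4Free.exists_complete_to_clique (h : IsP4Free G) {S Q : Finset V}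
    (hS : G.IsIndepSet S) (hne : S.Nonempty) (hQ : G.IsClique Q)
    (hdom : ∀ q ∈ Q, ∃ s ∈ S, G.Adj s q) : ∃ s ∈ S, ∀ q ∈ Q, G.Adj s q := by
  classical
  obtain ⟨s, hs, hmax⟩ := S.exists_max_image (fun s => (Q.filter (G.Adj s)).card) hne
  refine ⟨s, hs, fun q hq => ?_⟩
  by_contra hsq
  obtain ⟨s', hs', hs'q⟩ := hdom q hq
  obtain ⟨q', hq', hsq', hs'q'⟩ : ∃ q' ∈ Q, G.Adj s q' ∧ ¬ G.Adj s' q' := by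
    by_contra! hsub
    refine (hmax s' hs').not_gt (Finset.card_lt_card ⟨fun x hx => ?_, fun hx => ?_⟩)
    · rw [Finset.mem_filter] at hx ⊢
      exact ⟨hx.1, hsub x hx.1 hx.2⟩
    · exact hsq (Finset.mem_filter.1 (hx (Finset.mem_filter.2 ⟨hq, hs'q⟩))).2
  have hss' : s ≠ s' := fun e => hsq (e ▸ hs'q)
  have hqq' : q' ≠ q := fun e => hsq (e ▸ hsq')
  exact hS hs hs' hss' (h hsq' (hQ hq' hq hqq') hs'q.symm hsq fun e => hs'q' e.symm)

theorem IsP4Free.exists_clique_coloring (h : IsP4Free G) (W : Finset V) :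
    ∃ Q ⊆ W, G.IsClique Q ∧ ∃ f : V → ℕ, (∀ u ∈ W, f u < Q.card) ∧
      ∀ u ∈ W, ∀ w ∈ W, G.Adj u w → f u ≠ f w := by
  classical
  induction W using Finset.strongInduction with
  | H W ih =>
    rcases W.eq_empty_or_nonempty with rfl | ⟨w₀, hw₀⟩
    · exact ⟨∅, by simp, by simp, fun _ => 0, by simp, by simp⟩
    obtain ⟨S, hw₀S, hS⟩ := (W.powerset.filter fun S : Finset V => G.IsIndepSet S).exists_le_maximal
      (a := ({w₀} : Finset V)) (by simp [hw₀, IsIndepSet])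
    have hSW : S ⊆ W := by simpa using (Finset.mem_filter.1 hS.prop).1
    have hSind : G.IsIndepSet S := (Finset.mem_filter.1 hS.prop).2
    have hne : S.Nonempty := ⟨w₀, hw₀S (Finset.mem_singleton_self w₀)⟩
    obtain ⟨Q, hQW, hQ, f, hf, hproper⟩ := ih (W \ S) (Finset.sdiff_ssubset hSW hne)
    have hSQ : Disjoint S Q := Finset.disjoint_of_subset_right hQW Finset.disjoint_sdiff
    have hdom : ∀ q ∈ Q, ∃ s ∈ S, G.Adj s q := by
      intro q hq
      have hqW := Finset.mem_sdiff.1 (hQW hq)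
      by_contra! hno
      refine hqW.2 (hS.le_of_ge (y := insert q S) ?_ (Finset.subset_insert q S)
        (Finset.mem_insert_self q S))
      rw [Finset.mem_filter, Finset.mem_powerset, Finset.coe_insert]
      exact ⟨Finset.insert_subset hqW.1 hSW, hSind.insert fun s hs _ =>
        ⟨fun e => hno s hs e.symm, hno s hs⟩⟩
    obtain ⟨s, hs, hsQ⟩ := h.exists_complete_to_clique hSind hne hQ hdom
    have hcard : (insert s Q).card = Q.card + 1 :=
      Finset.card_insert_of_notMem (Finset.disjoint_left.1 hSQ hs)
    refine ⟨insert s Q, Finset.insert_subset (hSW hs) (hQW.trans Finset.sdiff_subset), ?_,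
      fun u => if u ∈ S then Q.card else f u, fun u hu => ?_, fun u hu w hw huw => ?_⟩
    · rw [Finset.coe_insert]
      exact hQ.insert fun q hq _ => hsQ q hq
    · have := hf u
      grind
    · have hu' := hf u
      have hw' := hf w
      have hp := hproper u
      have hi : u ∈ S → w ∈ S → False := fun h₁ h₂ => hSind h₁ h₂ huw.ne huw
      grind

theorem IsP4Free.chromaticNumber_eq_cliqueNum [Finite V] (h : IsP4Free G) :
    G.chromaticNumber = G.cliqueNum := by
  have := Fintype.ofFinite V
  refine le_antisymm ?_ G.cliqueNum_le_chromaticNumber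
  obtain ⟨Q, -, hQ, f, hf, hproper⟩ := h.exists_clique_coloring Finset.univ
  have hcol : G.Colorable Q.card :=
    ⟨Coloring.mk (fun u => ⟨f u, hf u (Finset.mem_univ u)⟩) fun {u w} huw e =>
      hproper u (Finset.mem_univ u) w (Finset.mem_univ w) huw (congrArg Fin.val e)⟩
  exact hcol.chromaticNumber_le.trans (by exact_mod_cast IsClique.card_le_cliqueNum (tc := hQ))

theorem IsP4Free.isPerfect [Finite V] (h : IsP4Free G) : IsPerfect G :=
  fun _ => (h.comap _).chromaticNumber_eq_cliqueNum

end P4Free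

section InducedSubgraphs

variable {V : Type*} {G : SimpleGraph V}

theorem IsFreeOf.eq_or_adj_of_path (h : IsFreeOf G graphP2P3) {p q a b c : V}
    (hpq : G.Adj p q) (hab : G.Adj a b) (hbc : G.Adj b c)
    (hpa : ¬ G.Adj p a) (hpb : ¬ G.Adj p b) (hpc : ¬ G.Adj p c)
    (hqa : ¬ G.Adj q a) (hqb : ¬ G.Adj q b) (hqc : ¬ G.Adj q c) : a = c ∨ G.Adj a c := by
  by_contra! hac
  refine h.false ⟨⟨![p, q, a, b, c], fun i j hij => ?_⟩, fun {i j} => ?_⟩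
  · fin_cases i <;> fin_cases j <;> simp at hij ⊢ <;> grind [SimpleGraph.adj_comm, SimpleGraph.Adj.ne]
  · change G.Adj (![p, q, a, b, c] i) (![p, q, a, b, c] j) ↔ _
    fin_cases i <;> fin_cases j <;> simp [graphP2P3] <;> grind [SimpleGraph.adj_comm]

theorem IsFreeOf.adj_of_dominated_path (h : IsFreeOf G graphGem) {x a b c d : V}
    (hxa : G.Adj x a) (hxb : G.Adj x b) (hxc : G.Adj x c) (hxd : G.Adj x d)
    (hab : G.Adj a b) (hbc : G.Adj b c) (hcd : G.Adj c d)
    (hac : ¬ G.Adj a c) (hbd : ¬ G.Adj b d) : G.Adj a d := by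
  by_contra had
  refine h.false ⟨⟨![a, b, c, d, x], fun i j hij => ?_⟩, fun {i j} => ?_⟩
  · fin_cases i <;> fin_cases j <;> simp at hij ⊢ <;> grind [SimpleGraph.adj_comm, SimpleGraph.Adj.ne]
  · change G.Adj (![a, b, c, d, x] i) (![a, b, c, d, x] j) ↔ _
    fin_cases i <;> fin_cases j <;> simp [graphGem] <;> grind [SimpleGraph.adj_comm]

theorem isFreeOf_graphP3 (h : ∀ a b c, G.Adj a b → G.Adj b c → a = c ∨ G.Adj a c) :
    IsFreeOf G graphP3 := by
  refine ⟨fun f => ?_⟩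
  rcases h (f 0) (f 1) (f 2) (f.map_adj_iff.2 (by simp [graphP3]))
    (f.map_adj_iff.2 (by simp [graphP3])) with e | e
  · exact absurd (f.injective e) (by decide)
  · exact absurd (f.map_adj_iff.1 e) (by simp [graphP3])

end InducedSubgraphs

section Cycle

variable {V : Type*} {G : SimpleGraph V}

/-- Let `r q p s` be an induced path. If every vertex of `S` other than `p` and `q` is nonadjacent
to `p` and `q`, and the common neighbours of `r` and `s` in `S` form a stable set, then `G[S]` is
`2`-colorable. -/
theorem chromaticNumber_induce_le_two [Finite V] (h1 : IsFreeOf G graphP2P3)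
    (h2 : IsFreeOf G graphGem) {p q r s : V} (hrq : G.Adj r q) (hqp : G.Adj q p)
    (hps : G.Adj p s) (hrp : ¬ G.Adj r p) (hqs : ¬ G.Adj q s) (hrs : ¬ G.Adj r s) {S : Set V}
    (hS : ∀ u ∈ S, u = p ∨ u = q ∨ ¬ G.Adj u p ∧ ¬ G.Adj u q)
    (hstab : ∀ u ∈ S, ∀ w ∈ S, G.Adj u r → G.Adj u s → G.Adj w r → G.Adj w s → ¬ G.Adj u w) :
    (G.induce S).chromaticNumber ≤ 2 := by
  have hpath : ∀ a ∈ S, ∀ b ∈ S, ∀ c ∈ S, G.Adj a b → G.Adj b c → a = c ∨ G.Adj a c := by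
    intro a ha b hb c hc hab hbc
    have := hS a ha
    have := hS b hb
    have := hS c hc
    by_cases hfar : (¬ G.Adj a p ∧ ¬ G.Adj a q) ∧ (¬ G.Adj b p ∧ ¬ G.Adj b q) ∧
        (¬ G.Adj c p ∧ ¬ G.Adj c q)
    · exact h1.eq_or_adj_of_path hqp hab hbc (by grind [SimpleGraph.adj_comm])
        (by grind [SimpleGraph.adj_comm]) (by grind [SimpleGraph.adj_comm])
        (by grind [SimpleGraph.adj_comm]) (by grind [SimpleGraph.adj_comm])
        (by grind [SimpleGraph.adj_comm])
    · grind [SimpleGraph.adj_comm]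
  have hP4 : IsP4Free (G.induce S) := by
    intro a b c d hab hbc _ hac _
    rcases hpath a a.2 b b.2 c c.2 hab hbc with e | e
    · rwa [Subtype.ext e]
    · exact absurd e hac
  have hedge : ∀ u ∈ S, ∀ w ∈ S, G.Adj u w → ¬ G.Adj u p → ¬ G.Adj u q → ¬ G.Adj w p →
      ¬ G.Adj w q → (G.Adj u r ∨ G.Adj w r) ∧ (G.Adj u s ∨ G.Adj w s) := by
    intro u _ w _ huw hup huq hwp hwq
    constructor
    · by_contra! hno
      rcases h1.eq_or_adj_of_path huw hrq hqp hno.1 huq hup hno.2 hwq hwp with e | e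
      · exact hqp.ne (by grind [SimpleGraph.adj_comm])
      · exact hrp e
    · by_contra! hno
      rcases h1.eq_or_adj_of_path huw hqp hps huq hup hno.1 hwq hwp hno.2 with e | e
      · exact hqp.ne (by grind [SimpleGraph.adj_comm])
      · exact hqs e
  have htriangle : ∀ x ∈ S, ∀ y ∈ S, ∀ z ∈ S, G.Adj x y → G.Adj x z → G.Adj y z → False := by
    have hgem : ∀ x y z, G.Adj x y → G.Adj x z → G.Adj y z → ¬ G.Adj x r → G.Adj x s →
        G.Adj y r → ¬ G.Adj y s → G.Adj z r → G.Adj z s → False :=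
      fun x y z hxy hxz hyz hxr hxs hyr hys hzr hzs =>
        hrs (h2.adj_of_dominated_path hzr hyz.symm hxz.symm hzs hyr.symm hxy.symm hxs
          (fun e => hxr e.symm) hys)
    intro x hx y hy z hz hxy hxz hyz
    have hfar : (¬ G.Adj x p ∧ ¬ G.Adj x q) ∧ (¬ G.Adj y p ∧ ¬ G.Adj y q) ∧
        (¬ G.Adj z p ∧ ¬ G.Adj z q) := by
      have := hS x hx
      have := hS y hy
      have := hS z hz
      grind [SimpleGraph.adj_comm, SimpleGraph.Adj.ne]
    obtain ⟨⟨hxp, hxq⟩, ⟨hyp, hyq⟩, hzp, hzq⟩ := hfar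
    have e₁ := hedge x hx y hy hxy hxp hxq hyp hyq
    have e₂ := hedge x hx z hz hxz hxp hxq hzp hzq
    have e₃ := hedge y hy z hz hyz hyp hyq hzp hzq
    have s₁ := hstab x hx y hy
    have s₂ := hstab x hx z hz
    have s₃ := hstab y hy z hz
    have g₁ := hgem x y z
    have g₂ := hgem y x z
    have g₃ := hgem x z y
    have g₄ := hgem z x y
    have g₅ := hgem y z x
    have g₆ := hgem z y x
    clear hS hstab hpath hP4 hedge hgem
    grind [SimpleGraph.adj_comm]
  rw [hP4.chromaticNumber_eq_cliqueNum]
  obtain ⟨Q, hQ⟩ := (G.induce S).exists_isNClique_cliqueNum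
  by_contra! hlt
  have hcard : 2 < Q.card := by
    rw [hQ.card_eq]
    exact_mod_cast hlt
  obtain ⟨x, y, z, hx, hy, hz, hxy, hxz, hyz⟩ := Finset.two_lt_card_iff.1 hcard
  exact htriangle x x.2 y y.2 z z.2 (hQ.isClique hx hy hxy) (hQ.isClique hx hz hxz)
    (hQ.isClique hy hz hyz)

theorem cliqueNum_induce_add_two_le [Finite V] {p q : V} (hpq : G.Adj p q) {Z : Set V}
    (hp : ∀ z ∈ Z, G.Adj p z) (hq : ∀ z ∈ Z, G.Adj q z) :
    (G.induce Z).cliqueNum + 2 ≤ G.cliqueNum := by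
  classical
  obtain ⟨Q, hQ⟩ := (G.induce Z).exists_isNClique_cliqueNum
  have hQG : G.IsNClique (G.induce Z).cliqueNum (Q.map (Function.Embedding.subtype _)) :=
    hQ.map.mono (map_comap_le _ _)
  have hmem : ∀ z ∈ Q.map (Function.Embedding.subtype _), z ∈ Z := by
    intro z hz
    obtain ⟨w, -, rfl⟩ := Finset.mem_map.1 hz
    exact w.2
  have hclique := (hQG.insert fun z hz => hp z (hmem z hz)).insert (a := q) fun z hz => by
    rcases Finset.mem_insert.1 hz with rfl | hz
    · exact hpq.symm
    · exact hq z (hmem z hz)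
  have := IsClique.card_le_cliqueNum (tc := hclique.isClique)
  rwa [hclique.card_eq] at this

end Cycle

/-- Properties (L1)–(L3) of the partition of a (P2+P3, gem)-free graph with
respect to an induced 5-cycle. -/
theorem properties_L1_L3 {V : Type*} [Fintype V] (G : SimpleGraph V)
    (h1 : IsFreeOf G graphP2P3) (h2 : IsFreeOf G graphGem)
    (v : Fin 5 → V) (hC : IsInducedC5 G v) :
    ∀ i : Fin 5,
      (IsFreeOf (G.induce (setX G v i)) graphP3 ∧
        ∀ x ∈ setX G v i, ∀ y ∈ setX G v i, ∀ z ∈ setX G v i,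
          G.Adj x y → G.Adj y z → x = z ∨ G.Adj x z) ∧
      (IsStableSet G (setX G v i) →
        (G.induce (setA G v i ∪ setA G v (i+1) ∪ setA G v (i-1) ∪ setB G v i ∪
          setB G v (i-1) ∪ setX G v i ∪ {v i, v (i+2), v (i-2)})).chromaticNumber ≤ 2) ∧
      (IsPerfect (G.induce (setZ G v i)) ∧
        (G.induce (setZ G v i)).chromaticNumber =
          ((G.induce (setZ G v i)).cliqueNum : ℕ∞) ∧
        (G.induce (setZ G v i)).cliqueNum ≤ G.cliqueNum - 2) := by
  intro i
  have hcyc : G.Adj (v (i + 1)) (v (i + 2)) ∧ G.Adj (v (i + 2)) (v (i - 2)) ∧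
      G.Adj (v (i - 2)) (v (i - 1)) ∧ ¬ G.Adj (v (i + 1)) (v (i - 2)) ∧
      ¬ G.Adj (v (i + 2)) (v (i - 1)) ∧ ¬ G.Adj (v (i + 1)) (v (i - 1)) := by
    simp only [hC.2]
    clear hC
    revert i
    decide
  obtain ⟨hrq, hqp, hps, hrp, hqs, hrs⟩ := hcyc
  have hXfar : ∀ u ∈ setX G v i, ¬ G.Adj (v (i + 2)) u ∧ ¬ G.Adj (v (i - 2)) u := by
    intro u hu
    rw [G.adj_comm, G.adj_comm _ u, hu.2, hu.2]
    clear hu hrq hqp hps hrp hqs hrs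
    revert i
    decide
  have hX : ∀ x ∈ setX G v i, ∀ y ∈ setX G v i, ∀ z ∈ setX G v i,
      G.Adj x y → G.Adj y z → x = z ∨ G.Adj x z := fun x hx y hy z hz hxy hyz =>
    h1.eq_or_adj_of_path hqp hxy hyz (hXfar x hx).1 (hXfar y hy).1 (hXfar z hz).1
      (hXfar x hx).2 (hXfar y hy).2 (hXfar z hz).2
  have hZadj : ∀ u ∈ setZ G v i,
      G.Adj (v i) u ∧ G.Adj (v (i + 2)) u ∧ G.Adj (v (i - 2)) u := by
    intro u hu
    simp [G.adj_comm _ u, hu.2]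
  have hZ : IsP4Free (G.induce (setZ G v i)) := fun a b c d hab hbc hcd hac hbd =>
    h2.adj_of_dominated_path (hZadj a a.2).1 (hZadj b b.2).1 (hZadj c c.2).1 (hZadj d d.2).1
      hab hbc hcd hac hbd
  refine ⟨⟨isFreeOf_graphP3 fun a b c hab hbc => ?_, hX⟩, fun hstab => ?_, hZ.isPerfect,
    hZ.chromaticNumber_eq_cliqueNum, Nat.le_sub_of_add_le (cliqueNum_induce_add_two_le hqp
      (fun z hz => (hZadj z hz).2.1) fun z hz => (hZadj z hz).2.2)⟩
  · exact (hX a a.2 b b.2 c c.2 hab hbc).imp_left Subtype.ext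
  have hclass : ∀ u ∈ setA G v i ∪ setA G v (i+1) ∪ setA G v (i-1) ∪ setB G v i ∪
      setB G v (i-1) ∪ setX G v i ∪ {v i, v (i+2), v (i-2)},
      (u = v (i - 2) ∨ u = v (i + 2) ∨ ¬ G.Adj u (v (i - 2)) ∧ ¬ G.Adj u (v (i + 2))) ∧
      (G.Adj u (v (i + 1)) → G.Adj u (v (i - 1)) → u ∈ setX G v i ∨ u = v i) := by
    rintro u ((((((hu | hu) | hu) | hu) | hu) | hu) | rfl | rfl | rfl)
    case inl.inr => exact ⟨.inr (.inr ⟨fun e => (hXfar u hu).2 e.symm,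
      fun e => (hXfar u hu).1 e.symm⟩), fun _ _ => .inl hu⟩
    case inr.inl =>
      refine ⟨.inr (.inr ?_), fun _ _ => .inr rfl⟩
      simp only [hC.2]
      clear hC hXfar hX hZadj hZ hstab hrq hqp hps hrp hqs hrs
      revert i
      decide
    case inr.inr.inl => exact ⟨.inr (.inl rfl), fun _ e => absurd e hqs⟩
    case inr.inr.inr => exact ⟨.inl rfl, fun e _ => absurd e.symm hrp⟩
    all_goals
      rw [hu.2, hu.2, hu.2, hu.2]
      clear hu hXfar hX hZadj hZ hstab hrq hqp hps hrp hqs hrs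
      have hfar : ∀ P Q R : Prop, ∀ {a b c d : Prop}, (¬ a ∧ ¬ b) ∧ ¬ (c ∧ d) →
          (P ∨ Q ∨ ¬ a ∧ ¬ b) ∧ (c → d → R) := by tauto
      apply hfar
      revert i
      decide
  refine chromaticNumber_induce_le_two h1 h2 hrq hqp hps hrp hqs hrs
    (fun u hu => (hclass u hu).1) fun u hu w hw hur hus hwr hws huw => ?_
  have hXc : ∀ x ∈ setX G v i, ¬ G.Adj x (v i) := by
    intro x hx
    have hi : ∀ i : Fin 5, ¬ (i = i - 1 ∨ i = i + 1) := by decide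
    rw [hx.2]
    exact hi i
  rcases (hclass u hu).2 hur hus with hu' | rfl <;> rcases (hclass w hw).2 hwr hws with hw' | rfl
  · exact hstab hu' hw' huw.ne huw
  · exact hXc u hu' huw
  · exact hXc w hw' huw.symm
  · exact huw.ne rfl
end

section
/- Let G be a (P2+P3, gem)-free graph containing an induced 5-cycle with vertex set C = {v1,…,v5} as in the setup, with the sets Y_i defined accordingly, and let W = {j ∈ {1,…,5} : Y_j ≠ ∅}. Then: (i) if |W| = 5, then G belongs to the class 𝒞, and hence χ(G) ≤ ⌈(5ω(G) − 1)/4⌉; (ii) if |W| = 4, then χ(G) ≤ ω(G) + 1. -/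
open SimpleGraph

/-- The neighbourhood of `u` on the cycle `v` is exactly `S`. -/
def HasTrace {V : Type*} (G : SimpleGraph V) (v : Fin 5 → V) (u : V) (S : Finset (Fin 5)) :
    Prop :=
  ∀ j, G.Adj u (v j) ↔ j ∈ S

/-- Two indices are equal or consecutive on the 5-cycle. -/
def Near (i j : Fin 5) : Prop := j = i ∨ j = i + 1 ∨ i = j + 1

instance (i j : Fin 5) : Decidable (Near i j) := by unfold Near; infer_instance

section Structure

variable {V : Type*} {G : SimpleGraph V} {v : Fin 5 → V}

lemma IsFreeOf.false_of_P2P3 (h : IsFreeOf G graphP2P3) {a b c d e : V}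
    (hab : G.Adj a b) (hcd : G.Adj c d) (hde : G.Adj d e) (hce : c ≠ e)
    (nac : ¬ G.Adj a c) (nad : ¬ G.Adj a d) (nae : ¬ G.Adj a e)
    (nbc : ¬ G.Adj b c) (nbd : ¬ G.Adj b d) (nbe : ¬ G.Adj b e)
    (nce : ¬ G.Adj c e) : False := by
  have key : ∀ i j : Fin 5, G.Adj (![a, b, c, d, e] i) (![a, b, c, d, e] j) ↔
      graphP2P3.Adj i j := by
    intro i j
    fin_cases i <;> fin_cases j <;>
      simp [graphP2P3, G.adj_comm, *]
  have inj : Function.Injective ![a, b, c, d, e] := by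
    have hac : a ≠ c := by rintro rfl; exact nad hcd
    have had : a ≠ d := by rintro rfl; exact nac hcd.symm
    have hae : a ≠ e := by rintro rfl; exact nad hde.symm
    have hbc : b ≠ c := by rintro rfl; exact nbd hcd
    have hbd : b ≠ d := by rintro rfl; exact nbc hcd.symm
    have hbe : b ≠ e := by rintro rfl; exact nbd hde.symm
    intro i j
    fin_cases i <;> fin_cases j <;>
      simp [hab.ne, hcd.ne, hde.ne, hab.ne', hcd.ne', hde.ne', hac.symm, had.symm, hae.symm,
        hbc.symm, hbd.symm, hbe.symm, hce.symm, *]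
  exact h.false ⟨⟨_, inj⟩, key _ _⟩

lemma IsFreeOf.false_of_gem (h : IsFreeOf G graphGem) {a b c d z : V}
    (hab : G.Adj a b) (hbc : G.Adj b c) (hcd : G.Adj c d)
    (hza : G.Adj z a) (hzb : G.Adj z b) (hzc : G.Adj z c) (hzd : G.Adj z d)
    (nac : ¬ G.Adj a c) (nad : ¬ G.Adj a d) (nbd : ¬ G.Adj b d) : False := by
  have key : ∀ i j : Fin 5, G.Adj (![a, b, c, d, z] i) (![a, b, c, d, z] j) ↔
      graphGem.Adj i j := by
    intro i j
    fin_cases i <;> fin_cases j <;>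
      simp [graphGem, G.adj_comm, hza.symm, hzb.symm, hzc.symm, hzd.symm, *]
  have inj : Function.Injective ![a, b, c, d, z] := by
    have hac : a ≠ c := by rintro rfl; exact nad hcd
    have had : a ≠ d := by rintro rfl; exact nac hcd.symm
    have hbd : b ≠ d := by rintro rfl; exact nad hab
    intro i j
    fin_cases i <;> fin_cases j <;>
      simp [hab.ne, hbc.ne, hcd.ne, hza.ne, hzb.ne, hzc.ne, hzd.ne, hab.ne', hbc.ne', hcd.ne',
        hza.ne', hzb.ne', hzc.ne', hzd.ne', hac.symm, had.symm, hbd.symm, *]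
  exact h.false ⟨⟨_, inj⟩, key _ _⟩

lemma IsInducedC5.rotate (hC : IsInducedC5 G v) (i : Fin 5) :
    IsInducedC5 G (fun j => v (j + i)) := by
  refine ⟨fun a b h => add_right_cancel (hC.1 h), fun a b => ?_⟩
  rw [hC.2]
  revert a b i
  decide

lemma HasTrace.rotate {u : V} {S T : Finset (Fin 5)} (hu : HasTrace G v u S) (i : Fin 5)
    (hT : T.image (· + i) = S) : HasTrace G (fun j => v (j + i)) u T := by
  intro j
  rw [hu, ← hT]
  simp

lemma hasTrace_cycle (hC : IsInducedC5 G v) (i : Fin 5) : HasTrace G v (v i) {i - 1, i + 1} := by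
  intro j
  rw [hC.2]
  revert i j
  decide

lemma mem_setY_iff (hC : IsInducedC5 G v) {u : V} {i : Fin 5} :
    u ∈ setY G v i ↔ HasTrace G v u {i - 1, i, i + 1} := by
  constructor
  · intro h j
    simpa using h.2 j
  · intro h
    refine ⟨?_, fun j => by simpa using h j⟩
    rintro ⟨k, rfl⟩
    have : ∀ j, (j ∈ ({k - 1, k + 1} : Finset (Fin 5)) ↔
        j ∈ ({i - 1, i, i + 1} : Finset (Fin 5))) :=
      fun j => (hasTrace_cycle hC k j).symm.trans (h j)
    clear h
    revert i k
    decide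

lemma adj_of_mem_setY_zero (h1 : IsFreeOf G graphP2P3) (hC : IsInducedC5 G v) {x y : V}
    (hx : HasTrace G v x {4, 0, 1}) (hy : HasTrace G v y {4, 0, 1}) (hxy : x ≠ y) :
    G.Adj x y := by
  by_contra h
  have hx' := fun j => (G.adj_comm (v j) x).trans (hx j)
  have hy' := fun j => (G.adj_comm (v j) y).trans (hy j)
  refine h1.false_of_P2P3 (a := v 2) (b := v 3) (c := x) (d := v 0) (e := y) ?_ ?_ ?_ hxy
    ?_ ?_ ?_ ?_ ?_ ?_ h <;> simp [hx _, hx', hy', hC.2]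

lemma adj_of_mem_setY_one (h2 : IsFreeOf G graphGem) (hC : IsInducedC5 G v) {x y : V}
    (hx : HasTrace G v x {4, 0, 1}) (hy : HasTrace G v y {0, 1, 2}) : G.Adj x y := by
  by_contra h
  have hx' := fun j => (G.adj_comm (v j) x).trans (hx j)
  have hy' := fun j => (G.adj_comm (v j) y).trans (hy j)
  refine h2.false_of_gem (a := v 4) (b := x) (c := v 1) (d := y) (z := v 0) ?_ ?_ ?_
    ?_ ?_ ?_ ?_ ?_ ?_ h <;> simp [hx _, hx', hy', hC.2]

lemma not_adj_of_mem_setY_two (h2 : IsFreeOf G graphGem) (hC : IsInducedC5 G v) {x y : V}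
    (hx : HasTrace G v x {4, 0, 1}) (hy : HasTrace G v y {1, 2, 3}) : ¬ G.Adj x y := by
  intro h
  have hx' := fun j => (G.adj_comm (v j) x).trans (hx j)
  have hy' := fun j => (G.adj_comm (v j) y).trans (hy j)
  refine h2.false_of_gem (a := v 0) (b := x) (c := y) (d := v 2) (z := v 1) ?_ h ?_
    ?_ ?_ ?_ ?_ ?_ ?_ ?_ <;> simp [hx _, hx', hy _, hy', hC.2]

lemma not_hasTrace_zero_of_Y1_Y3 (h1 : IsFreeOf G graphP2P3) (h2 : IsFreeOf G graphGem)
    (hC : IsInducedC5 G v) {u y1 y3 : V} (hne : ∀ j, u ≠ v j)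
    (hy1 : HasTrace G v y1 {0, 1, 2})
    (hy3 : HasTrace G v y3 {2, 3, 4})
    (hyy : ¬ G.Adj y1 y3) :
    ¬ HasTrace G v u {0} := by
  intro hu
  have hk0 : G.Adj u y3 := by
    by_contra h
    refine h1.false_of_P2P3 (a := v 3) (b := y3) (c := u) (d := v 0) (e := v 1)
      ?_ ?_ ?_ ?_ ?_ ?_ ?_ ?_ ?_ ?_ ?_ <;>
      simp [hu _, hC.2, hy3 _, G.adj_comm, *]
  have hk1 : G.Adj u y1 := by
    by_contra h
    refine h1.false_of_P2P3 (a := v 1) (b := y1) (c := u) (d := y3) (e := v 3)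
      ?_ ?_ ?_ ?_ ?_ ?_ ?_ ?_ ?_ ?_ ?_ <;>
      simp [hu _, hC.2, hy1 _, hy3 _, G.adj_comm, *]
  refine h2.false_of_gem (a := u) (b := v 0) (c := v 1) (d := v 2) (z := y1)
    ?_ ?_ ?_ ?_ ?_ ?_ ?_ ?_ ?_ ?_ <;>
    simp [hu _, hC.2, hy1 _, G.adj_comm, *]

lemma not_hasTrace_zero_of_Y2_Y4 (h1 : IsFreeOf G graphP2P3) (h2 : IsFreeOf G graphGem)
    (hC : IsInducedC5 G v) {u y2 y4 : V} (hne : ∀ j, u ≠ v j)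
    (hy2 : HasTrace G v y2 {1, 2, 3})
    (hy4 : HasTrace G v y4 {3, 4, 0})
    (hyy : ¬ G.Adj y2 y4) :
    ¬ HasTrace G v u {0} := by
  intro hu
  have hk0 : G.Adj u y2 := by
    by_contra h
    refine h1.false_of_P2P3 (a := v 2) (b := y2) (c := u) (d := v 0) (e := v 4)
      ?_ ?_ ?_ ?_ ?_ ?_ ?_ ?_ ?_ ?_ ?_ <;>
      simp [hu _, hC.2, hy2 _, G.adj_comm, *]
  have hk1 : ¬ G.Adj u y4 := by
    intro h
    refine h2.false_of_gem (a := u) (b := v 0) (c := v 4) (d := v 3) (z := y4)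
      ?_ ?_ ?_ ?_ ?_ ?_ ?_ ?_ ?_ ?_ <;>
      simp [hu _, hC.2, hy4 _, G.adj_comm, *]
  refine h1.false_of_P2P3 (a := v 4) (b := y4) (c := u) (d := y2) (e := v 1)
    ?_ ?_ ?_ ?_ ?_ ?_ ?_ ?_ ?_ ?_ ?_ <;>
    simp [hu _, hC.2, hy2 _, hy4 _, G.adj_comm, *]

lemma not_hasTrace_zero_one_of_Y2 (h1 : IsFreeOf G graphP2P3) (h2 : IsFreeOf G graphGem)
    (hC : IsInducedC5 G v) {u y2 : V} (hne : ∀ j, u ≠ v j)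
    (hy2 : HasTrace G v y2 {1, 2, 3}) :
    ¬ HasTrace G v u {0, 1} := by
  intro hu
  have hk0 : G.Adj u y2 := by
    by_contra h
    refine h1.false_of_P2P3 (a := v 2) (b := y2) (c := u) (d := v 0) (e := v 4)
      ?_ ?_ ?_ ?_ ?_ ?_ ?_ ?_ ?_ ?_ ?_ <;>
      simp [hu _, hC.2, hy2 _, G.adj_comm, *]
  refine h2.false_of_gem (a := v 0) (b := u) (c := y2) (d := v 2) (z := v 1)
    ?_ ?_ ?_ ?_ ?_ ?_ ?_ ?_ ?_ ?_ <;>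
    simp [hu _, hC.2, hy2 _, G.adj_comm, *]

lemma not_hasTrace_zero_one_of_Y4 (h1 : IsFreeOf G graphP2P3) (h2 : IsFreeOf G graphGem)
    (hC : IsInducedC5 G v) {u y4 : V} (hne : ∀ j, u ≠ v j)
    (hy4 : HasTrace G v y4 {3, 4, 0}) :
    ¬ HasTrace G v u {0, 1} := by
  intro hu
  have hk0 : G.Adj u y4 := by
    by_contra h
    refine h1.false_of_P2P3 (a := v 4) (b := y4) (c := u) (d := v 1) (e := v 2)
      ?_ ?_ ?_ ?_ ?_ ?_ ?_ ?_ ?_ ?_ ?_ <;>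
      simp [hu _, hC.2, hy4 _, G.adj_comm, *]
  refine h2.false_of_gem (a := v 1) (b := u) (c := y4) (d := v 4) (z := v 0)
    ?_ ?_ ?_ ?_ ?_ ?_ ?_ ?_ ?_ ?_ <;>
    simp [hu _, hC.2, hy4 _, G.adj_comm, *]

lemma not_hasTrace_four_one_of_Y2 (h1 : IsFreeOf G graphP2P3) (h2 : IsFreeOf G graphGem)
    (hC : IsInducedC5 G v) {u y2 : V} (hne : ∀ j, u ≠ v j)
    (hy2 : HasTrace G v y2 {1, 2, 3}) :
    ¬ HasTrace G v u {4, 1} := by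
  intro hu
  have hk0 : G.Adj u y2 := by
    by_contra h
    refine h1.false_of_P2P3 (a := v 2) (b := y2) (c := u) (d := v 4) (e := v 0)
      ?_ ?_ ?_ ?_ ?_ ?_ ?_ ?_ ?_ ?_ ?_ <;>
      simp [hu _, hC.2, hy2 _, G.adj_comm, *]
  refine h2.false_of_gem (a := u) (b := v 1) (c := v 2) (d := v 3) (z := y2)
    ?_ ?_ ?_ ?_ ?_ ?_ ?_ ?_ ?_ ?_ <;>
    simp [hu _, hC.2, hy2 _, G.adj_comm, *]

lemma not_hasTrace_four_one_of_Y3 (h1 : IsFreeOf G graphP2P3) (h2 : IsFreeOf G graphGem)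
    (hC : IsInducedC5 G v) {u y3 : V} (hne : ∀ j, u ≠ v j)
    (hy3 : HasTrace G v y3 {2, 3, 4}) :
    ¬ HasTrace G v u {4, 1} := by
  intro hu
  have hk0 : G.Adj u y3 := by
    by_contra h
    refine h1.false_of_P2P3 (a := v 3) (b := y3) (c := u) (d := v 1) (e := v 0)
      ?_ ?_ ?_ ?_ ?_ ?_ ?_ ?_ ?_ ?_ ?_ <;>
      simp [hu _, hC.2, hy3 _, G.adj_comm, *]
  refine h2.false_of_gem (a := u) (b := v 4) (c := v 3) (d := v 2) (z := y3)
    ?_ ?_ ?_ ?_ ?_ ?_ ?_ ?_ ?_ ?_ <;>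
    simp [hu _, hC.2, hy3 _, G.adj_comm, *]

lemma not_hasTrace_three_zero_two_of_Y1 (h1 : IsFreeOf G graphP2P3) (h2 : IsFreeOf G graphGem)
    (hC : IsInducedC5 G v) {u y1 : V} (hne : ∀ j, u ≠ v j)
    (hy1 : HasTrace G v y1 {0, 1, 2}) :
    ¬ HasTrace G v u {3, 0, 2} := by
  intro hu
  have hk0 : G.Adj u y1 := by
    by_contra h
    refine h1.false_of_P2P3 (a := v 1) (b := y1) (c := u) (d := v 3) (e := v 4)
      ?_ ?_ ?_ ?_ ?_ ?_ ?_ ?_ ?_ ?_ ?_ <;>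
      simp [hu _, hC.2, hy1 _, G.adj_comm, *]
  refine h2.false_of_gem (a := v 0) (b := y1) (c := v 2) (d := v 3) (z := u)
    ?_ ?_ ?_ ?_ ?_ ?_ ?_ ?_ ?_ ?_ <;>
    simp [hu _, hC.2, hy1 _, G.adj_comm, *]

lemma not_hasTrace_three_zero_two_of_Y4 (h1 : IsFreeOf G graphP2P3) (h2 : IsFreeOf G graphGem)
    (hC : IsInducedC5 G v) {u y4 : V} (hne : ∀ j, u ≠ v j)
    (hy4 : HasTrace G v y4 {3, 4, 0}) :
    ¬ HasTrace G v u {3, 0, 2} := by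
  intro hu
  have hk0 : G.Adj u y4 := by
    by_contra h
    refine h1.false_of_P2P3 (a := v 4) (b := y4) (c := u) (d := v 2) (e := v 1)
      ?_ ?_ ?_ ?_ ?_ ?_ ?_ ?_ ?_ ?_ ?_ <;>
      simp [hu _, hC.2, hy4 _, G.adj_comm, *]
  refine h2.false_of_gem (a := v 0) (b := y4) (c := v 3) (d := v 2) (z := u)
    ?_ ?_ ?_ ?_ ?_ ?_ ?_ ?_ ?_ ?_ <;>
    simp [hu _, hC.2, hy4 _, G.adj_comm, *]

lemma not_four_mem_trace (h2 : IsFreeOf G graphGem) (hC : IsInducedC5 G v) {u : V}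
    {S : Finset (Fin 5)} (hS : {0, 1, 2, 3} ⊆ S) : ¬ HasTrace G v u S := by
  intro hu
  have hu' : ∀ j ∈ ({0, 1, 2, 3} : Finset (Fin 5)), G.Adj u (v j) :=
    fun j hj => (hu j).2 (hS hj)
  refine h2.false_of_gem (a := v 0) (b := v 1) (c := v 2) (d := v 3) (z := u) ?_ ?_ ?_
    ?_ ?_ ?_ ?_ ?_ ?_ ?_ <;> simp [hu', hC.2]

lemma not_adj_of_hasTrace_empty (h1 : IsFreeOf G graphP2P3) (hC : IsInducedC5 G v) {x y : V}
    (hx : HasTrace G v x ∅) (hy : HasTrace G v y ∅) : ¬ G.Adj x y := by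
  intro h
  refine h1.false_of_P2P3 (a := x) (b := y) (c := v 0) (d := v 1) (e := v 2) h
    ?_ ?_ ?_ ?_ ?_ ?_ ?_ ?_ ?_ ?_ <;> simp [hx _, hy _, hC.2, hC.1.eq_iff]

lemma not_adj_hasTrace_empty_zero (h1 : IsFreeOf G graphP2P3) (hC : IsInducedC5 G v) {x y : V}
    (hx : HasTrace G v x ∅) (hne : ∀ j, x ≠ v j) (hy : HasTrace G v y {4, 0, 1}) :
    ¬ G.Adj x y := by
  intro h
  have hx' := fun j => (G.adj_comm (v j) x).trans (hx j)
  have hy' := fun j => (G.adj_comm (v j) y).trans (hy j)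
  refine h1.false_of_P2P3 (a := v 2) (b := v 3) (c := x) (d := y) (e := v 0) ?_ h ?_ (hne 0)
    ?_ ?_ ?_ ?_ ?_ ?_ ?_ <;> simp [hx _, hx', hy _, hy', hC.2]

lemma hasTrace_rotate_of_mem_setY (hC : IsInducedC5 G v) {y : V} (i k : Fin 5)
    (hy : y ∈ setY G v (k + i)) :
    HasTrace G (fun j => v (j + i)) y {k - 1, k, k + 1} :=
  ((mem_setY_iff hC).1 hy).rotate i (by clear hy; revert i k; decide)

lemma adj_setY_iff (h1 : IsFreeOf G graphP2P3) (h2 : IsFreeOf G graphGem)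
    (hC : IsInducedC5 G v) {x y : V} {i j : Fin 5} (hx : x ∈ setY G v i)
    (hy : y ∈ setY G v j) (hxy : x ≠ y) : G.Adj x y ↔ Near i j := by
  have main : ∀ (i : Fin 5) (x y : V), x ∈ setY G v i →
      (y ∈ setY G v (0 + i) → x ≠ y → G.Adj x y) ∧ (y ∈ setY G v (1 + i) → G.Adj x y) ∧
      (y ∈ setY G v (2 + i) → ¬ G.Adj x y) := by
    intro i x y hx
    have hx' := hasTrace_rotate_of_mem_setY hC i 0 (by rwa [zero_add])
    exact ⟨fun hy => adj_of_mem_setY_zero h1 (hC.rotate i) hx'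
        (hasTrace_rotate_of_mem_setY hC i 0 hy),
      fun hy => adj_of_mem_setY_one h2 (hC.rotate i) hx'
        (hasTrace_rotate_of_mem_setY hC i 1 hy),
      fun hy => not_adj_of_mem_setY_two h2 (hC.rotate i) hx'
        (hasTrace_rotate_of_mem_setY hC i 2 hy)⟩
  have hcases : ∀ i j : Fin 5, (j = 0 + i ∧ Near i j) ∨ (j = 1 + i ∧ Near i j) ∨
      (i = 1 + j ∧ Near i j) ∨ (j = 2 + i ∧ ¬ Near i j) ∨ (i = 2 + j ∧ ¬ Near i j) := by
    decide
  rcases hcases i j with ⟨h, hn⟩ | ⟨h, hn⟩ | ⟨h, hn⟩ | ⟨h, hn⟩ | ⟨h, hn⟩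
  · exact iff_of_true ((main i x y hx).1 (h ▸ hy) hxy) hn
  · exact iff_of_true ((main i x y hx).2.1 (h ▸ hy)) hn
  · exact iff_of_true ((main j y x hy).2.1 (h ▸ hx)).symm hn
  · exact iff_of_false ((main i x y hx).2.2 (h ▸ hy)) hn
  · exact iff_of_false (fun ha => (main j y x hy).2.2 (h ▸ hx) ha.symm) hn

lemma not_adj_hasTrace_empty_setY (h1 : IsFreeOf G graphP2P3) (hC : IsInducedC5 G v) {x y : V}
    {i : Fin 5} (hx : HasTrace G v x ∅) (hne : ∀ j, x ≠ v j) (hy : y ∈ setY G v i) :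
    ¬ G.Adj x y :=
  not_adj_hasTrace_empty_zero h1 (hC.rotate i) (hx.rotate i rfl) (fun _ => hne _)
    (hasTrace_rotate_of_mem_setY hC i 0 (by rwa [zero_add]))

lemma hasTrace_empty_or_mem_setY (h1 : IsFreeOf G graphP2P3) (h2 : IsFreeOf G graphGem)
    (hC : IsInducedC5 G v) {c : Fin 5} (hW : ∀ j ≠ c, (setY G v j).Nonempty) {u : V}
    (hne : ∀ j, u ≠ v j) : HasTrace G v u ∅ ∨ ∃ i, u ∈ setY G v i := by
  classical
  have : Nonempty V := ⟨u⟩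
  choose! y hy using hW
  have hy' : ∀ i k, k + i ≠ c → HasTrace G (fun j => v (j + i)) (y (k + i)) {k - 1, k, k + 1} :=
    fun i k hk => hasTrace_rotate_of_mem_setY hC i k (hy _ hk)
  have hyy : ∀ i j, i ≠ c → j ≠ c → ¬ Near i j → ¬ G.Adj (y i) (y j) := by
    intro i j hi hj hn
    have hij : y i ≠ y j := by
      intro h
      have h' := fun k => ((mem_setY_iff hC).1 (hy i hi) k).symm.trans
        (h ▸ (mem_setY_iff hC).1 (hy j hj) k)
      clear hy' hy hi hj h
      revert i j
      decide
    rwa [adj_setY_iff h1 h2 hC (hy i hi) (hy j hj) hij]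
  have key : ∀ S : Finset (Fin 5), S = ∅ ∨ ∃ i, S = {i - 1, i, i + 1} ∨
      Finset.image (· + i) {0} = S ∨ Finset.image (· + i) {0, 1} = S ∨
      Finset.image (· + i) {4, 1} = S ∨ Finset.image (· + i) {3, 0, 2} = S ∨
      Finset.image (· + i) {0, 1, 2, 3} = S ∨ Finset.image (· + i) {0, 1, 2, 3, 4} = S := by
    decide
  have hu : HasTrace G v u (Finset.univ.filter fun j => G.Adj u (v j)) := fun j => by simp
  generalize (Finset.univ.filter fun j => G.Adj u (v j)) = S at hu
  rcases key S with rfl | ⟨i, rfl | h | h | h | h | h | h⟩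
  · exact Or.inl hu
  · exact Or.inr ⟨i, (mem_setY_iff hC).2 hu⟩
  all_goals
    exfalso
    have hC' := hC.rotate i
    have hu' := hu.rotate i h
    have hne' : ∀ j, u ≠ (fun j => v (j + i)) j := fun j => hne _
  · by_cases hc : c = 1 + i ∨ c = 3 + i
    · have h2c : 2 + i ≠ c := by clear * - hc; revert i c; decide
      have h4c : 4 + i ≠ c := by clear * - hc; revert i c; decide
      exact not_hasTrace_zero_of_Y2_Y4 h1 h2 hC' hne' (hy' i 2 h2c) (hy' i 4 h4c)
        (hyy _ _ h2c h4c (by clear * -; revert i; decide)) hu'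
    · push Not at hc
      exact not_hasTrace_zero_of_Y1_Y3 h1 h2 hC' hne' (hy' i 1 hc.1.symm) (hy' i 3 hc.2.symm)
        (hyy _ _ hc.1.symm hc.2.symm (by clear * -; revert i; decide)) hu'
  · by_cases hc : 2 + i = c
    · exact not_hasTrace_zero_one_of_Y4 h1 h2 hC' hne' (hy' i 4 (by rw [← hc]; simp)) hu'
    · exact not_hasTrace_zero_one_of_Y2 h1 h2 hC' hne' (hy' i 2 hc) hu'
  · by_cases hc : 2 + i = c
    · exact not_hasTrace_four_one_of_Y3 h1 h2 hC' hne' (hy' i 3 (by rw [← hc]; simp)) hu'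
    · exact not_hasTrace_four_one_of_Y2 h1 h2 hC' hne' (hy' i 2 hc) hu'
  · by_cases hc : 1 + i = c
    · exact not_hasTrace_three_zero_two_of_Y4 h1 h2 hC' hne' (hy' i 4 (by rw [← hc]; simp)) hu'
    · exact not_hasTrace_three_zero_two_of_Y1 h1 h2 hC' hne' (hy' i 1 hc) hu'
  · exact not_four_mem_trace h2 hC' (by decide) hu'
  · exact not_four_mem_trace h2 hC' (by decide) hu'

lemma adj_blob_iff (h1 : IsFreeOf G graphP2P3) (h2 : IsFreeOf G graphGem)
    (hC : IsInducedC5 G v) {x y : V} {i j : Fin 5} (hx : x = v i ∨ x ∈ setY G v i)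
    (hy : y = v j ∨ y ∈ setY G v j) : G.Adj x y ↔ x ≠ y ∧ Near i j := by
  rcases eq_or_ne x y with rfl | hxy
  · simp
  simp only [hxy, ne_eq, not_false_eq_true, true_and]
  rcases hx with rfl | hx <;> rcases hy with rfl | hy
  · rw [hC.2]
    have : i ≠ j := by rintro rfl; exact hxy rfl
    simp [Near, this.symm]
  · rw [G.adj_comm, hy.2]
    clear hy hxy
    revert i j
    decide
  · rw [hx.2]
    clear hx hxy
    revert i j
    decide
  · exact adj_setY_iff h1 h2 hC hx hy hxy

/-- The graph is a clique blowup of `C5` plus isolated vertices, presented by the map `f`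
sending a vertex to the index of its blob, or to `none` if it is isolated. -/
structure IsBlobMap (G : SimpleGraph V) (f : V → Option (Fin 5)) : Prop where
  exists_eq : ∀ i, ∃ x, f x = some i
  adj_iff : ∀ x y, G.Adj x y ↔ x ≠ y ∧ ∃ i j, f x = some i ∧ f y = some j ∧ Near i j

lemma exists_isBlobMap (h1 : IsFreeOf G graphP2P3) (h2 : IsFreeOf G graphGem)
    (hC : IsInducedC5 G v) {c : Fin 5} (hW : ∀ j ≠ c, (setY G v j).Nonempty) :
    ∃ f : V → Option (Fin 5), IsBlobMap G f ∧ ∀ x i, f x = some i ↔ x = v i ∨ x ∈ setY G v i := by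
  have uniq : ∀ x i j, (x = v i ∨ x ∈ setY G v i) → (x = v j ∨ x ∈ setY G v j) → i = j := by
    rintro x i j (rfl | hi) (h | hj)
    · exact hC.1 h
    · exact absurd ⟨i, rfl⟩ hj.1
    · exact absurd ⟨j, h.symm⟩ hi.1
    · have h' := fun k => ((mem_setY_iff hC).1 hi k).symm.trans ((mem_setY_iff hC).1 hj k)
      clear hi hj
      revert i j
      decide
  have ex : ∀ x, ∃ o : Option (Fin 5), ∀ i, o = some i ↔ (x = v i ∨ x ∈ setY G v i) := by
    intro x
    by_cases hx : ∃ i, x = v i ∨ x ∈ setY G v i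
    · obtain ⟨i, hi⟩ := hx
      refine ⟨some i, fun j => ⟨?_, fun hj => congrArg some (uniq x i j hi hj)⟩⟩
      rintro ⟨⟩
      exact hi
    · push Not at hx
      exact ⟨none, fun j => by simp [hx j]⟩
  choose f hf using ex
  have isolated : ∀ x y, (¬ ∃ i, f x = some i) → ¬ G.Adj x y := by
    intro x y hx hadj
    simp only [hf] at hx
    push Not at hx
    have hne : ∀ j, x ≠ v j := fun j => (hx j).1
    have hxT : HasTrace G v x ∅ :=
      (hasTrace_empty_or_mem_setY h1 h2 hC hW hne).resolve_right
        fun ⟨i, hi⟩ => (hx i).2 hi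
    by_cases hy : ∃ j, y = v j
    · obtain ⟨j, rfl⟩ := hy
      simpa using (hxT j).1 hadj
    · push Not at hy
      rcases hasTrace_empty_or_mem_setY h1 h2 hC hW hy with hyT | ⟨j, hj⟩
      · exact not_adj_of_hasTrace_empty h1 hC hxT hyT hadj
      · exact not_adj_hasTrace_empty_setY h1 hC hxT hne hj hadj
  refine ⟨f, ⟨fun i => ⟨v i, (hf _ _).2 (Or.inl rfl)⟩, fun x y => ⟨fun hadj => ?_, ?_⟩⟩, hf⟩
  · obtain ⟨i, hi⟩ := not_not.1 fun h => isolated x y h hadj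
    obtain ⟨j, hj⟩ := not_not.1 fun h => isolated y x h hadj.symm
    have := (adj_blob_iff h1 h2 hC ((hf _ _).1 hi) ((hf _ _).1 hj)).1 hadj
    exact ⟨this.1, i, j, hi, hj, this.2⟩
  · rintro ⟨hxy, i, j, hi, hj, hn⟩
    exact (adj_blob_iff h1 h2 hC ((hf _ _).1 hi) ((hf _ _).1 hj)).2 ⟨hxy, hn⟩

end Structure

section Coloring

/-- The blowup of `C5` with blob sizes `t` admits a colouring with `k` colours, given as a choice
of the set of colours used on each blob. -/
lemma exists_disjoint_color_sets (t : Fin 5 → ℕ) (k : ℕ) (hpair : ∀ i, t i + t (i + 1) ≤ k)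
    (hsum : ∑ i, t i ≤ 2 * k) :
    ∃ S : Fin 5 → Finset ℕ, (∀ i, S i ⊆ Finset.range k) ∧ (∀ i, (S i).card = t i) ∧
      ∀ i, Disjoint (S i) (S (i + 1)) := by
  have p0 : t 0 + t 1 ≤ k := hpair 0
  have p1 : t 1 + t 2 ≤ k := hpair 1
  have p2 : t 2 + t 3 ≤ k := hpair 2
  have p3 : t 3 + t 4 ≤ k := hpair 3
  have p4 : t 4 + t 0 ≤ k := hpair 4
  rw [Fin.sum_univ_five] at hsum
  obtain ⟨r, hr⟩ : ∃ r, k = t 0 + t 1 + r := ⟨k - (t 0 + t 1), by omega⟩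
  let s := t 0 + t 1
  let S1 := Finset.Ico 0 (t 1)
  let S0 := Finset.Ico (t 1) s
  let S2 := Finset.Ico s (s + min (t 2) r) ∪ Finset.Ico (t 1) (t 1 + (t 2 - r))
  let S4 := Finset.Ico s (s + min (t 4) r) ∪ Finset.Ico 0 (t 4 - r)
  have c2 : S2.card = t 2 := by
    rw [Finset.card_union_of_disjoint]
    · simp only [Nat.card_Ico]
      omega
    · rw [Finset.disjoint_left]
      simp only [Finset.mem_Ico]
      omega
  have c4 : S4.card = t 4 := by
    rw [Finset.card_union_of_disjoint]
    · simp only [Nat.card_Ico]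
      omega
    · rw [Finset.disjoint_left]
      simp only [Finset.mem_Ico]
      omega
  have c24 : t 3 ≤ (Finset.range k \ (S2 ∪ S4)).card := by
    have hsub : S2 ∪ S4 ⊆ Finset.Ico s (s + max (min (t 2) r) (min (t 4) r)) ∪
        Finset.Ico (t 1) (t 1 + (t 2 - r)) ∪ Finset.Ico 0 (t 4 - r) := by
      intro x
      simp only [S2, S4, Finset.mem_union, Finset.mem_Ico]
      omega
    have h1 := Finset.card_le_card hsub
    have h2 := Finset.card_union_le (Finset.Ico s (s + max (min (t 2) r) (min (t 4) r)) ∪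
      Finset.Ico (t 1) (t 1 + (t 2 - r))) (Finset.Ico 0 (t 4 - r))
    have h3 := Finset.card_union_le (Finset.Ico s (s + max (min (t 2) r) (min (t 4) r)))
      (Finset.Ico (t 1) (t 1 + (t 2 - r)))
    have h4 := Finset.le_card_sdiff (S2 ∪ S4) (Finset.range k)
    simp only [Nat.card_Ico, Finset.card_range] at h1 h2 h3 h4
    omega
  obtain ⟨S3, hS3, c3⟩ := Finset.exists_subset_card_eq c24
  have hS3' : ∀ x ∈ S3, x < k ∧ x ∉ S2 ∧ x ∉ S4 := by
    intro x hx
    simpa using hS3 hx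
  refine ⟨![S0, S1, S2, S3, S4], ?_, ?_, ?_⟩
  · rw [Fin.forall_fin_succ, Fin.forall_fin_succ, Fin.forall_fin_succ, Fin.forall_fin_two]
    refine ⟨?_, ?_, ?_, fun x hx => Finset.mem_range.2 (hS3' x hx).1, ?_⟩ <;> intro x hx <;>
      simp [S0, S1, S2, S4, s] at hx ⊢ <;> omega
  · rw [Fin.forall_fin_succ, Fin.forall_fin_succ, Fin.forall_fin_succ, Fin.forall_fin_two]
    refine ⟨?_, ?_, c2, c3, c4⟩ <;> simp [S0, S1, s]
  · rw [Fin.forall_fin_succ, Fin.forall_fin_succ, Fin.forall_fin_succ, Fin.forall_fin_two]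
    simp only [Finset.disjoint_left]
    refine ⟨?_, ?_, fun x hx hx' => (hS3' x hx').2.1 hx, fun x hx => (hS3' x hx).2.2, ?_⟩ <;>
      intro x hx hx' <;> simp [S0, S1, S2, S4, s] at hx hx' <;> omega

variable {V : Type*} [Fintype V] {G : SimpleGraph V} {f : V → Option (Fin 5)}

/-- The number of vertices in the blob with index `i`. -/
def blobSize (f : V → Option (Fin 5)) (i : Fin 5) : ℕ := Fintype.card {x // f x = some i}

lemma IsBlobMap.blobSize_pos (hf : IsBlobMap G f) (i : Fin 5) : 0 < blobSize f i := by
  obtain ⟨x, hx⟩ := hf.exists_eq i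
  exact Fintype.card_pos_iff.2 ⟨⟨x, hx⟩⟩

lemma IsBlobMap.blobSize_add_le_cliqueNum (hf : IsBlobMap G f) (i : Fin 5) :
    blobSize f i + blobSize f (i + 1) ≤ G.cliqueNum := by
  classical
  have hcl : G.IsClique ((Finset.univ.filter fun x => f x = some i) ∪
      (Finset.univ.filter fun x => f x = some (i + 1)) : Finset V) := by
    intro x hx y hy hxy
    have hnear : ∀ i : Fin 5, Near i i ∧ Near i (i + 1) ∧ Near (i + 1) i := by decide
    simp only [Finset.coe_union, Finset.coe_filter, Finset.mem_univ, true_and, Set.mem_union,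
      Set.mem_ofPred_eq] at hx hy
    refine (hf.adj_iff x y).2 ⟨hxy, ?_⟩
    rcases hx with hx | hx <;> rcases hy with hy | hy
    · exact ⟨i, i, hx, hy, (hnear i).1⟩
    · exact ⟨i, i + 1, hx, hy, (hnear i).2.1⟩
    · exact ⟨i + 1, i, hx, hy, (hnear i).2.2⟩
    · exact ⟨i + 1, i + 1, hx, hy, (hnear (i + 1)).1⟩
  have hcard := hcl.card_le_cliqueNum
  rw [Finset.card_union_of_disjoint] at hcard
  · simpa [blobSize, Fintype.card_subtype] using hcard
  · rw [Finset.disjoint_left]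
    simp only [Finset.mem_filter, Finset.mem_univ, true_and]
    intro x hx hx'
    rw [hx, Option.some_inj] at hx'
    clear hcl hcard hx
    revert i
    decide

lemma IsBlobMap.inClassC (hf : IsBlobMap G f) : InClassC G := by
  classical
  refine ⟨blobSize f, Fintype.card {x // f x = none}, hf.blobSize_pos, ?_⟩
  let e : ∀ i, {x // f x = some i} ≃ Fin (blobSize f i) := fun i => Fintype.equivFin _
  let e₀ : {x // f x = none} ≃ Fin (Fintype.card {x // f x = none}) := Fintype.equivFin _
  let g : (Σ i : Fin 5, Fin (blobSize f i)) ⊕ Fin (Fintype.card {x // f x = none}) → V :=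
    Sum.elim (fun p => ((e p.1).symm p.2).1) (fun q => (e₀.symm q).1)
  have hg : ∀ p, f (g (Sum.inl p)) = some p.1 := fun p => ((e p.1).symm p.2).2
  have hg₀ : ∀ q, f (g (Sum.inr q)) = none := fun q => (e₀.symm q).2
  have inj : Function.Injective g := by
    rintro (⟨i, p⟩ | p) (⟨j, q⟩ | q) h
    · obtain rfl : i = j := by
        have := congrArg f h
        rwa [hg, hg, Option.some_inj] at this
      have hpq : p = q := (e i).symm.injective (Subtype.ext h)
      rw [hpq]
    · have := congrArg f h
      rw [hg, hg₀] at this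
      cases this
    · have := congrArg f h
      rw [hg, hg₀] at this
      cases this
    · have hpq : p = q := e₀.symm.injective (Subtype.ext h)
      rw [hpq]
  have surj : Function.Surjective g := by
    intro x
    rcases hx : f x with _ | i
    · exact ⟨Sum.inr (e₀ ⟨x, hx⟩), by simp [g]⟩
    · exact ⟨Sum.inl ⟨i, e i ⟨x, hx⟩⟩, by simp [g]⟩
  refine ⟨(⟨Equiv.ofBijective g ⟨inj, surj⟩, ?_⟩ : blowupC5 _ _ ≃g G).symm⟩
  intro a b
  change G.Adj (g a) (g b) ↔ _
  rw [hf.adj_iff, inj.ne_iff]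
  simp only [blowupC5, SimpleGraph.fromRel_adj]
  refine and_congr_right fun _ => ?_
  rcases a with a | a <;> rcases b with b | b <;> simp only [hg, hg₀] <;> simp [Near]
  constructor
  · rintro (h | h | h) <;> simp [h]
  · rintro ((h | h) | (h | h)) <;> simp [h]

lemma IsBlobMap.colorable (hf : IsBlobMap G f) {k : ℕ}
    (hpair : ∀ i, blobSize f i + blobSize f (i + 1) ≤ k)
    (hsum : ∑ i, blobSize f i ≤ 2 * k) : G.Colorable k := by
  classical
  have hk : 0 < k := lt_of_lt_of_le (Nat.add_pos_left (hf.blobSize_pos 0) _) (hpair 0)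
  obtain ⟨S, hSk, hcard, hdisj⟩ := exists_disjoint_color_sets (blobSize f) k hpair hsum
  let e : ∀ i, {x // f x = some i} ≃ S i := fun i =>
    Fintype.equivOfCardEq (by rw [Fintype.card_coe, hcard, blobSize])
  have hc : ∀ x, ∃ n : Fin k, ∀ i (hx : f x = some i), (n : ℕ) = e i ⟨x, hx⟩ := by
    intro x
    rcases Option.eq_none_or_eq_some (f x) with hx | ⟨i, hx⟩
    · exact ⟨⟨0, hk⟩, fun i hi => by simp [hx] at hi⟩
    · refine ⟨⟨e i ⟨x, hx⟩, Finset.mem_range.1 (hSk i (e i ⟨x, hx⟩).2)⟩, ?_⟩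
      intro j hj
      obtain rfl : i = j := Option.some_inj.1 (hx.symm.trans hj)
      rfl
  choose c hc using hc
  refine ⟨SimpleGraph.Coloring.mk c fun {x y} hadj heq => ?_⟩
  obtain ⟨hxy, i, j, hi, hj, hn⟩ := (hf.adj_iff x y).1 hadj
  have hval : (e i ⟨x, hi⟩ : ℕ) = e j ⟨y, hj⟩ := by rw [← hc x i hi, ← hc y j hj, heq]
  have hmem := (e i ⟨x, hi⟩).2
  have hmem' := (e j ⟨y, hj⟩).2
  rcases hn with rfl | rfl | rfl
  · exact hxy (congrArg Subtype.val ((e j).injective (Subtype.ext hval)))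
  · exact Finset.disjoint_left.1 (hdisj i) hmem (hval ▸ hmem')
  · exact Finset.disjoint_left.1 (hdisj j) hmem' (hval ▸ hmem)

end Coloring

/-- If all five sets `Y_j` are nonempty then `G ∈ 𝒞` (hence `χ(G) ≤ ⌈(5ω-1)/4⌉`);
if exactly four are nonempty, then `χ(G) ≤ ω(G) + 1`. -/
theorem W_five_or_four {V : Type*} [Fintype V] (G : SimpleGraph V)
    (h1 : IsFreeOf G graphP2P3) (h2 : IsFreeOf G graphGem)
    (v : Fin 5 → V) (hC : IsInducedC5 G v) :
    (({j : Fin 5 | (setY G v j).Nonempty}).ncard = 5 →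
      InClassC G ∧
        G.chromaticNumber ≤ ((⌈(5 * (G.cliqueNum : ℚ) - 1) / 4⌉₊ : ℕ) : ℕ∞)) ∧
    (({j : Fin 5 | (setY G v j).Nonempty}).ncard = 4 →
      G.chromaticNumber ≤ (G.cliqueNum : ℕ∞) + 1) := by
  classical
  set W : Set (Fin 5) := {j | (setY G v j).Nonempty}
  have hcompl : W.ncard + Wᶜ.ncard = 5 := by simpa using Set.ncard_add_ncard_compl W
  constructor
  · intro hcard
    have hall : ∀ j, (setY G v j).Nonempty := by
      intro j
      have : Wᶜ = ∅ := (Set.ncard_eq_zero (Set.toFinite _)).1 (by omega)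
      exact (Set.compl_empty_iff.1 this ▸ Set.mem_univ j : j ∈ W)
    obtain ⟨f, hf, -⟩ := exists_isBlobMap h1 h2 hC (c := 0) fun j _ => hall j
    refine ⟨hf.inClassC, SimpleGraph.Colorable.chromaticNumber_le ?_⟩
    have hceil : 5 * G.cliqueNum ≤ 4 * ⌈(5 * (G.cliqueNum : ℚ) - 1) / 4⌉₊ + 1 := by
      have := Nat.le_ceil ((5 * (G.cliqueNum : ℚ) - 1) / 4)
      have h' : (5 * G.cliqueNum : ℚ) ≤ 4 * ⌈(5 * (G.cliqueNum : ℚ) - 1) / 4⌉₊ + 1 := by linarith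
      exact_mod_cast h'
    have hω := hf.blobSize_add_le_cliqueNum
    have hpos := hf.blobSize_pos 0
    have p0 := hω 0
    refine hf.colorable (fun i => (hω i).trans (by omega)) ?_
    have p1 : blobSize f 1 + blobSize f 2 ≤ G.cliqueNum := hω 1
    have p2 : blobSize f 2 + blobSize f 3 ≤ G.cliqueNum := hω 2
    have p3 : blobSize f 3 + blobSize f 4 ≤ G.cliqueNum := hω 3
    have p4 : blobSize f 4 + blobSize f 0 ≤ G.cliqueNum := hω 4
    rw [zero_add] at p0
    rw [Fin.sum_univ_five]
    omega
  · intro hcard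
    obtain ⟨c, hc⟩ := Set.ncard_eq_one.1 (show Wᶜ.ncard = 1 by omega)
    have hmem : ∀ j, ¬ (setY G v j).Nonempty ↔ j = c := by
      intro j
      change j ∈ Wᶜ ↔ _
      simp [hc]
    obtain ⟨f, hf, hfv⟩ := exists_isBlobMap h1 h2 hC (c := c) fun j hj => by
      by_contra h
      exact hj ((hmem j).1 h)
    have hone : blobSize f c = 1 := by
      refine Fintype.card_eq_one_iff.2 ⟨⟨v c, (hfv _ _).2 (Or.inl rfl)⟩, fun ⟨x, hx⟩ => ?_⟩
      exact Subtype.ext (((hfv _ _).1 hx).resolve_right fun h => (hmem c).2 rfl ⟨x, h⟩)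
    have hω := hf.blobSize_add_le_cliqueNum
    suffices h : G.Colorable (G.cliqueNum + 1) by exact_mod_cast h.chromaticNumber_le
    refine hf.colorable (fun i => (hω i).trans (Nat.le_succ _)) ?_
    have p0 : blobSize f 0 + blobSize f 1 ≤ G.cliqueNum := hω 0
    have p1 : blobSize f 1 + blobSize f 2 ≤ G.cliqueNum := hω 1
    have p2 : blobSize f 2 + blobSize f 3 ≤ G.cliqueNum := hω 2
    have p3 : blobSize f 3 + blobSize f 4 ≤ G.cliqueNum := hω 3
    have p4 : blobSize f 4 + blobSize f 0 ≤ G.cliqueNum := hω 4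
    rw [Fin.sum_univ_five]
    fin_cases c <;> simp at hone <;> omega
end

section
/- Let G be a (P2+P3, gem)-free graph containing an induced 5-cycle with vertex set C = {v1,…,v5} as in the setup, with the sets B_i, X_i, Y_i, Y defined accordingly. If G is moreover F1-free, then for each i ∈ {1,…,5} (indices mod 5): (i) Y is empty; (ii) X_i is a stable set; (iii) at least one of X_i and B_{i−2} ∪ B_{i+1} is empty. -/
open SimpleGraph

/-- An `H`-free graph admits no injective adjacency-preserving and -reflecting map from `H`. -/
theorem IsFreeOf.elim {W V : Type*} {G : SimpleGraph V} {H : SimpleGraph W} (h : IsFreeOf G H)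
    (f : W → V) (hf : Function.Injective f) (hadj : ∀ a b, G.Adj (f a) (f b) ↔ H.Adj a b) :
    False :=
  h.false ⟨⟨f, hf⟩, hadj _ _⟩

open Function in
/-- Replacing `v i` by a vertex of `X_i` yields another induced `C5`. -/
theorem IsInducedC5.update {V : Type*} {G : SimpleGraph V} {v : Fin 5 → V}
    (hC : IsInducedC5 G v) {i : Fin 5} {x : V} (hx : x ∈ setX G v i) :
    IsInducedC5 G (update v i x) := by
  obtain ⟨hxr, hxa⟩ := hx
  have hne (j : Fin 5) : v j ≠ x := fun h => hxr ⟨j, h⟩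
  refine ⟨fun a b hab => ?_, fun a b => ?_⟩
  · by_cases ha : a = i <;> by_cases hb : b = i
    · exact ha.trans hb.symm
    · simp [ha, hb, (hne b).symm] at hab
    · simp [ha, hb, hne a] at hab
    · exact hC.1 (by simpa [ha, hb] using hab)
  · by_cases ha : a = i <;> by_cases hb : b = i
    · subst ha hb
      simp
    · subst ha
      rw [update_self, update_of_ne hb, hxa]
      grind
    · subst hb
      rw [update_self, update_of_ne ha, G.adj_comm, hxa]
      grind
    · simpa [ha, hb] using hC.2 a b

/-- In an `F1`-free graph, no vertex sees exactly three consecutive vertices of an induced `C5`. -/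
theorem setY_eq_empty {V : Type*} {G : SimpleGraph V} (hF1 : IsFreeOf G graphF1)
    {v : Fin 5 → V} (hC : IsInducedC5 G v) (j : Fin 5) : setY G v j = ∅ := by
  refine Set.eq_empty_of_forall_notMem fun u ⟨hur, hua⟩ => ?_
  have hne (k : Fin 5) : v k ≠ u := fun h => hur ⟨k, h⟩
  have hau (k : Fin 5) : G.Adj (v k) u ↔ (k = j - 1 ∨ k = j ∨ k = j + 1) := by
    rw [G.adj_comm, hua]
  refine hF1.elim ![v j, v (j + 1), v (j + 2), v (j + 3), v (j + 4), u] ?_ ?_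
  · intro a b
    fin_cases a <;> fin_cases b <;> simp [hne, (hne _).symm, hC.1.eq_iff]
  · intro a b
    fin_cases a <;> fin_cases b <;> simp [hC.2, hua, hau, graphF1] <;> clear * - <;>
      revert j <;> decide

/-- In a `P2 + P3`-free graph, an edge `ab` is not anticomplete to an induced path `cde`. -/
theorem IsFreeOf.not_edge_anticomplete_path {V : Type*} {G : SimpleGraph V}
    (h : IsFreeOf G graphP2P3) {a b c d e : V} (hab : G.Adj a b) (hcd : G.Adj c d)
    (hde : G.Adj d e) (hce : c ≠ e) (hce' : ¬ G.Adj c e) (hac : ¬ G.Adj a c)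
    (had : ¬ G.Adj a d) (hae : ¬ G.Adj a e) (hbc : ¬ G.Adj b c) (hbd : ¬ G.Adj b d)
    (hbe : ¬ G.Adj b e) : False := by
  refine h.elim ![a, b, c, d, e] ?_ ?_
  · intro p q
    fin_cases p <;> fin_cases q <;> simp <;> grind [SimpleGraph.adj_comm, SimpleGraph.irrefl]
  · intro p q
    fin_cases p <;> fin_cases q <;> simp [graphP2P3] <;> grind [SimpleGraph.adj_comm]

/-- If moreover `G` is `F1`-free, then `Y = ∅`, each `X_i` is stable, and at least
one of `X_i` and `B_{i-2} ∪ B_{i+1}` is empty. -/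
theorem F1_free_properties {V : Type*} [Fintype V] (G : SimpleGraph V)
    (h1 : IsFreeOf G graphP2P3) (h2 : IsFreeOf G graphGem)
    (hF1 : IsFreeOf G graphF1)
    (v : Fin 5 → V) (hC : IsInducedC5 G v) :
    ∀ i : Fin 5,
      (⋃ j, setY G v j) = ∅ ∧
      IsStableSet G (setX G v i) ∧
      (setX G v i = ∅ ∨ setB G v (i-2) ∪ setB G v (i+1) = ∅) := by
  intro i
  have key {x u : V} (hx : x ∈ setX G v i) (hur : u ∉ Set.range v) (hux : G.Adj u x)
      (k : Fin 5) (hk : i = k - 1 ∨ i = k ∨ i = k + 1)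
      (hu : ∀ j, j ≠ i → (G.Adj u (v j) ↔ (j = k - 1 ∨ j = k ∨ j = k + 1))) : False := by
    refine Set.eq_empty_iff_forall_notMem.1 (setY_eq_empty hF1 (hC.update hx) k) u ⟨?_, fun j => ?_⟩
    · rintro ⟨j, rfl⟩
      by_cases hj : j = i
      · subst hj
        simp at hux
      · exact hur ⟨j, by simp [hj]⟩
    · by_cases hj : j = i
      · subst hj
        simpa [hux] using hk
      · simpa [hj] using hu j hj
  refine ⟨by simp [setY_eq_empty hF1 hC], fun x hx u hu _ hxu => ?_, ?_⟩
  · refine key hx hu.1 hxu.symm i (by simp) fun j hj => ?_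
    rw [hu.2]
    simp [hj]
  · rw [or_iff_not_imp_left, ← ne_eq, ← Set.nonempty_iff_ne_empty]
    rintro ⟨x, hx⟩
    have hxa (j : Fin 5) : G.Adj (v j) x ↔ (j = i - 1 ∨ j = i + 1) := by
      rw [G.adj_comm, hx.2]
    have hix : v i ≠ x := fun h => hx.1 ⟨i, h⟩
    refine Set.eq_empty_of_forall_notMem ?_
    rintro b (hb | hb)
    · by_cases hbx : G.Adj b x
      · refine key hx hb.1 hbx (i - 1) (by simp) fun j hj => ?_
        rw [hb.2]
        clear * - hj
        revert i j
        decide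
      · refine h1.not_edge_anticomplete_path (a := b) (b := v (i - 2)) (c := v i)
          (d := v (i + 1)) (e := x) ?_ ?_ ?_ hix ?_ ?_ ?_ hbx ?_ ?_ ?_ <;>
        simp only [hb.2, hC.2, hxa] <;> clear * - <;> revert i <;> decide
    · by_cases hbx : G.Adj b x
      · refine key hx hb.1 hbx (i + 1) (by simp) fun j hj => ?_
        rw [hb.2]
        clear * - hj
        revert i j
        decide
      · refine h1.not_edge_anticomplete_path (a := b) (b := v (i + 2)) (c := v i)
          (d := v (i - 1)) (e := x) ?_ ?_ ?_ hix ?_ ?_ ?_ hbx ?_ ?_ ?_ <;>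
        simp only [hb.2, hC.2, hxa] <;> clear * - <;> revert i <;> decide
end

section
/- Let G be a (P2+P3, gem)-free graph containing an induced 5-cycle. If G is moreover (F1, F2, F3)-free, then ω(G) ≤ 3. -/
open SimpleGraph

namespace CliqueTraces

set_option synthInstance.maxSize 1000
set_option synthInstance.maxHeartbeats 200000

variable {V W : Type*} {G : SimpleGraph V} {H : SimpleGraph W}

/-- An adjacency-preserving and -reflecting map from a graph without false twins is an induced
embedding. -/
theorem not_adj_iff_of_isFreeOf (h : IsFreeOf G H)
    (hH : ∀ i j, (∀ k, H.Adj i k ↔ H.Adj j k) → i = j) (f : W → V) :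
    ¬ ∀ i j, G.Adj (f i) (f j) ↔ H.Adj i j := by
  intro hf
  refine h.false ⟨⟨f, fun i j hij => hH i j fun k => ?_⟩, hf _ _⟩
  rw [← hf, ← hf, hij]

theorem forall_iff_of_lt [LinearOrder W] {f : W → V}
    (hf : ∀ i j, i < j → (G.Adj (f i) (f j) ↔ H.Adj i j)) (i j : W) :
    G.Adj (f i) (f j) ↔ H.Adj i j := by
  rcases lt_trichotomy i j with hij | rfl | hij
  · exact hf i j hij
  · simp
  · rw [G.adj_comm, H.adj_comm, hf j i hij]

theorem gem_false (h : IsFreeOf G graphGem) (f : Fin 5 → V)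
    (hf : ∀ i j, i < j → (G.Adj (f i) (f j) ↔ graphGem.Adj i j)) : False :=
  not_adj_iff_of_isFreeOf h (by simp only [graphGem, fromRel_adj]; decide) f (forall_iff_of_lt hf)

theorem f1_false (h : IsFreeOf G graphF1) (f : Fin 6 → V)
    (hf : ∀ i j, i < j → (G.Adj (f i) (f j) ↔ graphF1.Adj i j)) : False :=
  not_adj_iff_of_isFreeOf h (by simp only [graphF1, fromRel_adj]; decide) f (forall_iff_of_lt hf)

theorem f2_false (h : IsFreeOf G graphF2) (f : Fin 7 → V)
    (hf : ∀ i j, i < j → (G.Adj (f i) (f j) ↔ graphF2.Adj i j)) : False :=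
  not_adj_iff_of_isFreeOf h (by simp only [graphF2, fromRel_adj]; decide) f (forall_iff_of_lt hf)

theorem f3_false (h : IsFreeOf G graphF3) (f : Fin 7 → V)
    (hf : ∀ i j, i < j → (G.Adj (f i) (f j) ↔ graphF3.Adj i j)) : False :=
  not_adj_iff_of_isFreeOf h (by simp only [graphF3, fromRel_adj]; decide) f (forall_iff_of_lt hf)

theorem p2p3_false (h : IsFreeOf G graphP2P3) (f : Fin 5 → V) (hne : f 2 ≠ f 4)
    (hf : ∀ i j, i < j → (G.Adj (f i) (f j) ↔ graphP2P3.Adj i j)) : False := by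
  have hf' := forall_iff_of_lt hf
  have twins : ∀ i j, (∀ k, graphP2P3.Adj i k ↔ graphP2P3.Adj j k) →
      i = j ∨ i = 2 ∧ j = 4 ∨ i = 4 ∧ j = 2 := by
    simp only [graphP2P3, fromRel_adj]; decide
  refine h.false ⟨⟨f, fun i j hij => ?_⟩, hf' _ _⟩
  rcases twins i j fun k => by rw [← hf', ← hf', hij] with h | ⟨rfl, rfl⟩ | ⟨rfl, rfl⟩
  · exact h
  · exact (hne hij).elim
  · exact (hne hij.symm).elim

/-- The difference of two subsets of `Fin 4` encoded as bit masks. -/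
def diff (x y : ℕ) : ℕ := x &&& (15 ^^^ y)

/-- The mask `x` has at most one bit set. -/
def atMostOne (x : ℕ) : Bool := x &&& (x - 1) == 0

theorem testBit_fifteen (a : Fin 4) : Nat.testBit 15 a = true := by
  revert a; decide

theorem testBit_diff (x y : ℕ) (a : Fin 4) :
    (diff x y).testBit a = (x.testBit a && !y.testBit a) := by
  simp [diff, testBit_fifteen]

theorem and_lt {x : ℕ} (hx : x < 16) (y : ℕ) : x &&& y < 16 :=
  Nat.and_le_left.trans_lt hx

theorem diff_lt {x : ℕ} (hx : x < 16) (y : ℕ) : diff x y < 16 :=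
  and_lt hx _

theorem exists_testBit {x : ℕ} (h : x ≠ 0) (hx : x < 16) : ∃ a : Fin 4, x.testBit a = true := by
  revert h; revert x; decide

theorem exists_two_testBit {x : ℕ} (h : ¬ atMostOne x = true) (hx : x < 16) :
    ∃ a b : Fin 4, a ≠ b ∧ x.testBit a = true ∧ x.testBit b = true := by
  revert h; revert x; decide

theorem exists_mask (p : Fin 4 → Prop) :
    ∃ x < 16, ∀ a : Fin 4, p a ↔ x.testBit a = true := by
  classical
  have : ∀ f : Fin 4 → Bool, ∃ x < 16, ∀ a : Fin 4, x.testBit a = f a := by decide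
  obtain ⟨x, hx, h⟩ := this fun a => decide (p a)
  exact ⟨x, hx, fun a => by simp [h]⟩

/-- The possible traces on a 4-clique of three consecutive vertices of a 5-cycle. -/
def okPath (x y z : ℕ) : Bool :=
  x &&& y &&& z == 0 && atMostOne (diff 15 (x ||| y ||| z)) &&
  (x &&& z == 0 || diff x z == 0 || diff z x == 0) &&
  (diff (x &&& y) z == 0 || diff (z &&& y) x == 0) &&
  (atMostOne (diff x (y ||| z)) || diff z (x ||| y) == 0) &&
  (atMostOne (diff z (y ||| x)) || diff x (z ||| y) == 0) &&
  (diff x (y ||| z) == 0 || diff y (x ||| z) == 0 || diff z (x ||| y) == 0 ||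
    diff 15 (x ||| y ||| z) == 0)

/-- The possible traces on a 4-clique of two consecutive vertices `x`, `y` of a 5-cycle and of the
vertex `z` opposite to them. -/
def okApex (x y z : ℕ) : Bool :=
  (diff (y &&& z) x == 0 && diff (x &&& z) y == 0) || x &&& y &&& z == 0

/-- The possible traces on a 4-clique of four consecutive vertices of a 5-cycle. -/
def okPath₄ (x y z t : ℕ) : Bool := atMostOne (diff (x &&& t) (y ||| z))

/-- The possible traces on a 4-clique of the vertices of a 5-cycle, listed in cyclic order. -/
def okCycle (x y z t u : ℕ) : Bool :=
  atMostOne (diff (x &&& z &&& t) (y ||| u)) &&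
  (diff (x &&& z &&& t) (y ||| u) == 0 || diff (z &&& t) (x ||| y ||| u) == 0)

/-- The conditions on the first four vertices `x`, `y`, `z`, `t` of a 5-cycle that
do not follow from `okPath x y z`. -/
def okFour (x y z t : ℕ) : Bool :=
  okPath y z t && okApex x y t && okApex z t x && okPath₄ x y z t

/-- The conditions on the vertices of a 5-cycle that involve its last vertex `u`. -/
def okFive (x y z t u : ℕ) : Bool :=
  okPath z t u && okPath t u x && okPath u x y &&
  okApex y z u && okApex t u y && okApex u x z &&
  okPath₄ y z t u && okPath₄ z t u x && okPath₄ t u x y && okPath₄ u x y z &&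
  okCycle x y z t u && okCycle y z t u x && okCycle z t u x y && okCycle t u x y z &&
  okCycle u x y z t

/-- All bit masks of subsets of `Fin 4`. -/
def masks : List ℕ := [0, 1, 2, 3, 4, 5, 6, 7, 8, 9, 10, 11, 12, 13, 14, 15]

theorem mem_masks {x : ℕ} (hx : x < 16) : x ∈ masks := by
  revert x; decide

theorem no_traces : ∀ x ∈ masks, ∀ y ∈ masks, y ≤ x → ∀ z ∈ masks, z ≤ x →
    okPath x y z = true → ∀ t ∈ masks, t ≤ x → okFour x y z t = true →
    ∀ u ∈ masks, u ≤ x → okFive x y z t u = false := by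
  decide +kernel

/-- A 5-cycle `v`, a 4-clique `w`, and masks `n` recording the adjacencies between them. -/
structure Config (G : SimpleGraph V) (v : Fin 5 → V) (w : Fin 4 → V) (n : Fin 5 → ℕ) :
    Prop where
  cycle : ∀ i j, G.Adj (v i) (v j) ↔ (j = i + 1 ∨ i = j + 1)
  clique : ∀ a b, G.Adj (w a) (w b) ↔ a ≠ b
  trace : ∀ a j, G.Adj (w a) (v j) ↔ (n j).testBit a = true
  lt : ∀ j, n j < 16

namespace Config

variable {v : Fin 5 → V} {w : Fin 4 → V} {n : Fin 5 → ℕ}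

theorem rotate (h : Config G v w n) (r : Fin 5) :
    Config G (fun i => v (i + r)) w (fun i => n (i + r)) where
  cycle i j := by rw [h.cycle]; revert i j r; decide
  clique := h.clique
  trace a j := h.trace a _
  lt j := h.lt _

theorem reflect (h : Config G v w n) : Config G (fun i => v (-i)) w (fun i => n (-i)) where
  cycle i j := by rw [h.cycle]; revert i j; decide
  clique := h.clique
  trace a j := h.trace a _
  lt j := h.lt _

theorem trace_symm (h : Config G v w n) (a : Fin 4) (j : Fin 5) :
    G.Adj (v j) (w a) ↔ (n j).testBit a = true := by rw [G.adj_comm, h.trace]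

theorem trace_path (h : Config G v w n) (h2 : IsFreeOf G graphGem) (hF1 : IsFreeOf G graphF1)
    {a : Fin 4} (h₀ : (n 0).testBit a = true) (h₁ : (n 1).testBit a = true)
    (h₂ : (n 2).testBit a = true) : False := by
  have gem : ∀ {v : Fin 5 → V} {n : Fin 5 → ℕ}, Config G v w n → (n 0).testBit a = true →
      (n 1).testBit a = true → (n 2).testBit a = true → (n 3).testBit a = true → False := by
    intro v n h h₀ h₁ h₂ h₃
    refine gem_false h2 ![v 0, v 1, v 2, v 3, w a] ?_
    simp [Fin.forall_fin_succ, graphGem, h.cycle, h.trace_symm, h₀, h₁, h₂, h₃]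
  cases h₃ : (n 3).testBit a
  · cases h₄ : (n 4).testBit a
    · refine f1_false hF1 ![v 1, v 2, v 3, v 4, v 0, w a] ?_
      simp [Fin.forall_fin_succ, graphF1, h.cycle, h.trace_symm, h₀, h₁, h₂, h₃, h₄]
    · exact gem (h.rotate 4) h₄ h₀ h₁ h₂
  · exact gem h h₀ h₁ h₂ h₃

theorem path_unseen (h : Config G v w n) (h1 : IsFreeOf G graphP2P3) {a b : Fin 4} (hab : a ≠ b)
    (ha₀ : (n 0).testBit a = false) (ha₁ : (n 1).testBit a = false)
    (ha₂ : (n 2).testBit a = false) (hb₀ : (n 0).testBit b = false)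
    (hb₁ : (n 1).testBit b = false) (hb₂ : (n 2).testBit b = false) : False := by
  refine p2p3_false h1 ![w a, w b, v 0, v 1, v 2] ?_ ?_
  · intro h02
    have := h.cycle 0 3
    have := h.cycle 2 3
    simp_all
  · simp [Fin.forall_fin_succ, graphP2P3, h.cycle, h.clique, h.trace, hab, ha₀, ha₁, ha₂, hb₀,
      hb₁, hb₂]

theorem trace_apex (h : Config G v w n) (h2 : IsFreeOf G graphGem) {a b : Fin 4}
    (ha0 : (n 0).testBit a = false) (ha1 : (n 1).testBit a = true) (ha3 : (n 3).testBit a = true)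
    (hb0 : (n 0).testBit b = true) (hb1 : (n 1).testBit b = true) (hb3 : (n 3).testBit b = true) :
    False := by
  have hab : a ≠ b := by rintro rfl; simp_all
  refine gem_false h2 ![v 0, v 1, w a, v 3, w b] ?_
  simp [Fin.forall_fin_succ, graphGem, h.cycle, h.clique, h.trace, h.trace_symm, hab, ha0, ha1,
    ha3, hb0, hb1, hb3]

theorem trace_laminar (h : Config G v w n) (h2 : IsFreeOf G graphGem) {a b c : Fin 4}
    (ha0 : (n 0).testBit a = true) (ha2 : (n 2).testBit a = false) (hb0 : (n 0).testBit b = false)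
    (hb2 : (n 2).testBit b = true) (hc0 : (n 0).testBit c = true) (hc2 : (n 2).testBit c = true) :
    False := by
  have hab : a ≠ b := by rintro rfl; simp_all
  have hac : a ≠ c := by rintro rfl; simp_all
  have hbc : b ≠ c := by rintro rfl; simp_all
  refine gem_false h2 ![v 0, w a, w b, v 2, w c] ?_
  simp [Fin.forall_fin_succ, graphGem, h.cycle, h.clique, h.trace, h.trace_symm, hab, hac, hbc,
    ha0, ha2, hb0, hb2, hc0, hc2]

theorem trace_middle (h : Config G v w n) (h2 : IsFreeOf G graphGem) {a b : Fin 4}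
    (ha0 : (n 0).testBit a = true) (ha1 : (n 1).testBit a = true) (ha2 : (n 2).testBit a = false)
    (hb0 : (n 0).testBit b = false) (hb1 : (n 1).testBit b = true)
    (hb2 : (n 2).testBit b = true) : False := by
  have hab : a ≠ b := by rintro rfl; simp_all
  refine gem_false h2 ![v 0, w a, w b, v 2, v 1] ?_
  simp [Fin.forall_fin_succ, graphGem, h.cycle, h.clique, h.trace, h.trace_symm, hab, ha0, ha1,
    ha2, hb0, hb1, hb2]

theorem trace_ends (h : Config G v w n) (hF1 : IsFreeOf G graphF1) {a b : Fin 4} (hab : a ≠ b)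
    (ha0 : (n 0).testBit a = true) (ha1 : (n 1).testBit a = false) (ha2 : (n 2).testBit a = false)
    (ha3 : (n 3).testBit a = true) (hb0 : (n 0).testBit b = true) (hb1 : (n 1).testBit b = false)
    (hb2 : (n 2).testBit b = false) (hb3 : (n 3).testBit b = true) : False := by
  refine f1_false hF1 ![w a, v 0, v 1, v 2, v 3, w b] ?_
  simp [Fin.forall_fin_succ, graphF1, h.cycle, h.clique, h.trace, h.trace_symm, hab, ha0, ha1,
    ha2, ha3, hb0, hb1, hb2, hb3]

theorem trace_two_first (h : Config G v w n) (hF1 : IsFreeOf G graphF1) {a b c : Fin 4}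
    (hab : a ≠ b) (ha0 : (n 0).testBit a = true) (ha1 : (n 1).testBit a = false)
    (ha2 : (n 2).testBit a = false) (hb0 : (n 0).testBit b = true) (hb1 : (n 1).testBit b = false)
    (hb2 : (n 2).testBit b = false) (hc0 : (n 0).testBit c = false)
    (hc1 : (n 1).testBit c = false) (hc2 : (n 2).testBit c = true) : False := by
  have hac : a ≠ c := by rintro rfl; simp_all
  have hbc : b ≠ c := by rintro rfl; simp_all
  refine f1_false hF1 ![w a, v 0, v 1, v 2, w c, w b] ?_
  simp [Fin.forall_fin_succ, graphF1, h.cycle, h.clique, h.trace, h.trace_symm, hab, hac,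
    hbc.symm, ha0, ha1, ha2, hb0, hb1, hb2, hc0, hc1, hc2]

theorem trace_two_triangles (h : Config G v w n) (hF2 : IsFreeOf G graphF2) {a b : Fin 4}
    (hab : a ≠ b) (ha0 : (n 0).testBit a = true) (ha1 : (n 1).testBit a = false)
    (ha2 : (n 2).testBit a = true) (ha3 : (n 3).testBit a = true) (ha4 : (n 4).testBit a = false)
    (hb0 : (n 0).testBit b = true) (hb1 : (n 1).testBit b = false) (hb2 : (n 2).testBit b = true)
    (hb3 : (n 3).testBit b = true) (hb4 : (n 4).testBit b = false) : False := by
  refine f2_false hF2 ![v 0, v 1, v 2, v 3, v 4, w a, w b] ?_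
  simp [Fin.forall_fin_succ, graphF2, h.cycle, h.clique, h.trace, h.trace_symm, hab, ha0, ha1,
    ha2, ha3, ha4, hb0, hb1, hb2, hb3, hb4]

theorem trace_triangle_edge (h : Config G v w n) (hF3 : IsFreeOf G graphF3) {a b : Fin 4}
    (ha0 : (n 0).testBit a = true) (ha1 : (n 1).testBit a = false) (ha2 : (n 2).testBit a = true)
    (ha3 : (n 3).testBit a = true) (ha4 : (n 4).testBit a = false) (hb0 : (n 0).testBit b = false)
    (hb1 : (n 1).testBit b = false) (hb2 : (n 2).testBit b = true) (hb3 : (n 3).testBit b = true)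
    (hb4 : (n 4).testBit b = false) : False := by
  have hab : a ≠ b := by rintro rfl; simp_all
  refine f3_false hF3 ![v 0, v 1, v 2, v 3, v 4, w a, w b] ?_
  simp [Fin.forall_fin_succ, graphF3, h.cycle, h.clique, h.trace, h.trace_symm, hab, ha0, ha1,
    ha2, ha3, ha4, hb0, hb1, hb2, hb3, hb4]

theorem trace_private (h : Config G v w n) (hF3 : IsFreeOf G graphF3) {a b c d : Fin 4}
    (ha0 : (n 0).testBit a = false) (ha1 : (n 1).testBit a = true) (ha4 : (n 4).testBit a = false)
    (hb0 : (n 0).testBit b = false) (hb1 : (n 1).testBit b = false) (hb4 : (n 4).testBit b = true)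
    (hc0 : (n 0).testBit c = true) (hc1 : (n 1).testBit c = false) (hc4 : (n 4).testBit c = false)
    (hd0 : (n 0).testBit d = false) (hd1 : (n 1).testBit d = false)
    (hd4 : (n 4).testBit d = false) : False := by
  have hab : a ≠ b := by rintro rfl; simp_all
  have hac : a ≠ c := by rintro rfl; simp_all
  have had : a ≠ d := by rintro rfl; simp_all
  have hbc : b ≠ c := by rintro rfl; simp_all
  have hbd : b ≠ d := by rintro rfl; simp_all
  have hcd : c ≠ d := by rintro rfl; simp_all
  refine f3_false hF3 ![v 0, v 1, w a, w b, v 4, w c, w d] ?_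
  simp [Fin.forall_fin_succ, graphF3, h.cycle, h.clique, h.trace, h.trace_symm, hab, hac, had,
    hbc, hbd, hcd, ha0, ha1, ha4, hb0, hb1, hb4, hc0, hc1, hc4, hd0, hd1, hd4]

theorem okPath_trace (h : Config G v w n) (h1 : IsFreeOf G graphP2P3) (h2 : IsFreeOf G graphGem)
    (hF1 : IsFreeOf G graphF1) (hF3 : IsFreeOf G graphF3) : okPath (n 0) (n 1) (n 2) = true := by
  simp only [okPath, Bool.and_eq_true, Bool.or_eq_true, beq_iff_eq, and_assoc, or_assoc]
  refine ⟨?_, ?_, ?_, ?_, ?_, ?_, ?_⟩ <;> by_contra hn <;> try rw [not_or] at hn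
  · obtain ⟨a, ha⟩ := exists_testBit hn (and_lt (and_lt (h.lt _) _) _)
    simp only [Nat.testBit_and, Bool.and_eq_true] at ha
    exact h.trace_path h2 hF1 ha.1.1 ha.1.2 ha.2
  · obtain ⟨a, b, hab, ha, hb⟩ := exists_two_testBit hn (diff_lt (by simp) _)
    simp [testBit_diff, testBit_fifteen] at ha hb
    exact h.path_unseen h1 hab ha.1.1 ha.1.2 ha.2 hb.1.1 hb.1.2 hb.2
  · rw [not_or] at hn
    obtain ⟨c, hc⟩ := exists_testBit hn.1 (and_lt (h.lt _) _)
    obtain ⟨a, ha⟩ := exists_testBit hn.2.1 (diff_lt (h.lt _) _)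
    obtain ⟨b, hb⟩ := exists_testBit hn.2.2 (diff_lt (h.lt _) _)
    simp [testBit_diff] at ha hb hc
    exact h.trace_laminar h2 ha.1 ha.2 hb.2 hb.1 hc.1 hc.2
  · obtain ⟨a, ha⟩ := exists_testBit hn.1 (diff_lt (and_lt (h.lt _) _) _)
    obtain ⟨b, hb⟩ := exists_testBit hn.2 (diff_lt (and_lt (h.lt _) _) _)
    simp [testBit_diff] at ha hb
    exact h.trace_middle h2 ha.1.1 ha.1.2 ha.2 hb.2 hb.1.2 hb.1.1
  · obtain ⟨a, b, hab, ha, hb⟩ := exists_two_testBit hn.1 (diff_lt (h.lt _) _)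
    obtain ⟨c, hc⟩ := exists_testBit hn.2 (diff_lt (h.lt _) _)
    simp [testBit_diff] at ha hb hc
    exact h.trace_two_first hF1 hab ha.1 ha.2.1 ha.2.2 hb.1 hb.2.1 hb.2.2 hc.2.1 hc.2.2 hc.1
  · obtain ⟨a, b, hab, ha, hb⟩ := exists_two_testBit hn.1 (diff_lt (h.lt _) _)
    obtain ⟨c, hc⟩ := exists_testBit hn.2 (diff_lt (h.lt _) _)
    simp [testBit_diff] at ha hb hc
    exact (h.reflect.rotate 3).trace_two_first hF1 hab ha.1 ha.2.1 ha.2.2 hb.1 hb.2.1 hb.2.2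
      hc.2.1 hc.2.2 hc.1
  · simp only [not_or] at hn
    obtain ⟨b, hb⟩ := exists_testBit hn.1 (diff_lt (h.lt _) _)
    obtain ⟨c, hc⟩ := exists_testBit hn.2.1 (diff_lt (h.lt _) _)
    obtain ⟨a, ha⟩ := exists_testBit hn.2.2.1 (diff_lt (h.lt _) _)
    obtain ⟨d, hd⟩ := exists_testBit hn.2.2.2 (diff_lt (by simp) _)
    simp [testBit_diff, testBit_fifteen] at ha hb hc hd
    exact (h.rotate 1).trace_private hF3 ha.2.2 ha.1 ha.2.1 hb.2.1 hb.2.2 hb.1 hc.1 hc.2.2 hc.2.1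
      hd.1.2 hd.2 hd.1.1

theorem okApex_trace (h : Config G v w n) (h2 : IsFreeOf G graphGem) :
    okApex (n 0) (n 1) (n 3) = true := by
  simp only [okApex, Bool.and_eq_true, Bool.or_eq_true, beq_iff_eq]
  by_contra hn
  rw [not_or] at hn
  obtain ⟨b, hb⟩ := exists_testBit hn.2 (and_lt (and_lt (h.lt _) _) _)
  simp only [Nat.testBit_and, Bool.and_eq_true] at hb
  refine hn.1 ⟨?_, ?_⟩ <;> by_contra hn'
  · obtain ⟨a, ha⟩ := exists_testBit hn' (diff_lt (and_lt (h.lt _) _) _)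
    simp [testBit_diff] at ha
    exact h.trace_apex h2 ha.2 ha.1.1 ha.1.2 hb.1.1 hb.1.2 hb.2
  · obtain ⟨a, ha⟩ := exists_testBit hn' (diff_lt (and_lt (h.lt _) _) _)
    simp [testBit_diff] at ha
    exact (h.reflect.rotate 4).trace_apex h2 ha.2 ha.1.1 ha.1.2 hb.1.2 hb.1.1 hb.2

theorem okPath₄_trace (h : Config G v w n) (hF1 : IsFreeOf G graphF1) :
    okPath₄ (n 0) (n 1) (n 2) (n 3) = true := by
  by_contra hn
  obtain ⟨a, b, hab, ha, hb⟩ := exists_two_testBit hn (diff_lt (and_lt (h.lt _) _) _)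
  simp [testBit_diff] at ha hb
  exact h.trace_ends hF1 hab ha.1.1 ha.2.1 ha.2.2 ha.1.2 hb.1.1 hb.2.1 hb.2.2 hb.1.2

theorem okCycle_trace (h : Config G v w n) (hF2 : IsFreeOf G graphF2)
    (hF3 : IsFreeOf G graphF3) : okCycle (n 0) (n 1) (n 2) (n 3) (n 4) = true := by
  simp only [okCycle, Bool.and_eq_true, Bool.or_eq_true, beq_iff_eq]
  refine ⟨?_, ?_⟩ <;> by_contra hn
  · obtain ⟨a, b, hab, ha, hb⟩ := exists_two_testBit hn (diff_lt (and_lt (and_lt (h.lt _) _) _) _)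
    simp [testBit_diff] at ha hb
    exact h.trace_two_triangles hF2 hab ha.1.1.1 ha.2.1 ha.1.1.2 ha.1.2 ha.2.2
      hb.1.1.1 hb.2.1 hb.1.1.2 hb.1.2 hb.2.2
  · rw [not_or] at hn
    obtain ⟨a, ha⟩ := exists_testBit hn.1 (diff_lt (and_lt (and_lt (h.lt _) _) _) _)
    obtain ⟨b, hb⟩ := exists_testBit hn.2 (diff_lt (and_lt (h.lt _) _) _)
    simp [testBit_diff] at ha hb
    exact h.trace_triangle_edge hF3 ha.1.1.1 ha.2.1 ha.1.1.2 ha.1.2 ha.2.2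
      hb.2.1.1 hb.2.1.2 hb.1.1 hb.1.2 hb.2.2

theorem elim_of_le (h : Config G v w n) (h1 : IsFreeOf G graphP2P3) (h2 : IsFreeOf G graphGem)
    (hF1 : IsFreeOf G graphF1) (hF2 : IsFreeOf G graphF2) (hF3 : IsFreeOf G graphF3)
    (hmax : ∀ j, n j ≤ n 0) : False := by
  have path r := (h.rotate r).okPath_trace h1 h2 hF1 hF3
  have apex r := (h.rotate r).okApex_trace h2
  have path₄ r := (h.rotate r).okPath₄_trace hF1
  have cycle r := (h.rotate r).okCycle_trace hF2 hF3
  have mem j := mem_masks (h.lt j)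
  have four : okFour (n 0) (n 1) (n 2) (n 3) = true := by
    simp only [okFour, Bool.and_eq_true]
    exact ⟨⟨⟨path 1, apex 0⟩, apex 2⟩, path₄ 0⟩
  have five : okFive (n 0) (n 1) (n 2) (n 3) (n 4) = true := by
    simp only [okFive, Bool.and_eq_true, and_assoc]
    exact ⟨path 2, path 3, path 4, apex 1, apex 3, apex 4, path₄ 1, path₄ 2, path₄ 3, path₄ 4,
      cycle 0, cycle 1, cycle 2, cycle 3, cycle 4⟩
  have := no_traces _ (mem 0) _ (mem 1) (hmax 1) _ (mem 2) (hmax 2) (path 0) _ (mem 3) (hmax 3)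
    four _ (mem 4) (hmax 4)
  simp [five] at this

theorem elim (h : Config G v w n) (h1 : IsFreeOf G graphP2P3) (h2 : IsFreeOf G graphGem)
    (hF1 : IsFreeOf G graphF1) (hF2 : IsFreeOf G graphF2) (hF3 : IsFreeOf G graphF3) : False := by
  obtain ⟨r, hr⟩ := Finite.exists_max n
  exact (h.rotate r).elim_of_le h1 h2 hF1 hF2 hF3 fun j => by simpa using hr (j + r)

end Config

end CliqueTraces

/-- A (P2+P3, gem, F1, F2, F3)-free graph containing an induced 5-cycle has
clique number at most 3. -/
theorem cliqueNum_le_three_of_F123_free {V : Type*} [Fintype V] (G : SimpleGraph V)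
    (h1 : IsFreeOf G graphP2P3) (h2 : IsFreeOf G graphGem)
    (hF1 : IsFreeOf G graphF1) (hF2 : IsFreeOf G graphF2) (hF3 : IsFreeOf G graphF3)
    (hC5 : Nonempty (graphC5 ↪g G)) :
    G.cliqueNum ≤ 3 := by
  by_contra! hlt
  obtain ⟨s, hs⟩ := G.exists_isNClique_cliqueNum
  obtain ⟨t, hts, ht⟩ := Finset.exists_subset_card_eq (hlt.trans_eq hs.card_eq.symm)
  obtain ⟨c⟩ := hC5
  let w : Fin 4 → V := fun a => t.equivFin.symm (Fin.cast ht.symm a)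
  have hw : Function.Injective w := Subtype.val_injective.comp
    (t.equivFin.symm.injective.comp (Fin.cast_injective _))
  choose n hn htrace using fun j => CliqueTraces.exists_mask fun a => G.Adj (w a) (c j)
  have h_config : CliqueTraces.Config G c w n :=
    { cycle := fun i j => by
        rw [c.map_adj_iff]
        revert i j
        simp only [graphC5, fromRel_adj]
        decide
      clique := fun a b => ⟨fun h hab => h.ne (congrArg w hab), fun hab =>
        hs.isClique (hts (t.equivFin.symm _).2) (hts (t.equivFin.symm _).2) (hw.ne hab)⟩
      trace := fun a j => htrace j a
      lt := hn }
  exact h_config.elim h1 h2 hF1 hF2 hF3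
end
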